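/- Under Assumptions (C), for any subdomain Ω' compactly contained in Ω there exist positive constants c₁, c₂ such that c₁|x − y| ≤ d₁(x,y) ≤ c₂|x − y|^{1/r} for all x, y ∈ Ω'. -/

import Mathlib

open MeasureTheory Set Topology

noncomputable section

/-- Euclidean space `ℝ^p`. -/
abbrev E (p : ℕ) : Type := EuclideanSpace ℝ (Fin p)

instance (p : ℕ) : Nonempty (E p) := ⟨0⟩

section Core

variable {V : Type*} [NormedAddCommGroup V] [NormedSpace ℝ V]

/-- Commutator of two vector fields: `[X,Y] = (DY)·X - (DX)·Y`. -/
def vComm (X Y : V → V) : V → V :=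
  fun x => fderiv ℝ Y x (X x) - fderiv ℝ X x (Y x)

/-- Left-iterated commutator `[X_{f 0},[X_{f 1},…,[X_{f (k-1)}, X_{f k}]…]]`. -/
def iterComm {ι : Type*} (X : ι → V → V) : (k : ℕ) → (Fin (k + 1) → ι) → V → V
  | 0, f => X (f 0)
  | k + 1, f => vComm (X (f 0)) (iterComm X k (fun j => f j.succ))

/-- Multiindices of length between `1` and `r` with entries in `ι`. -/
def MIdx (ι : Type*) (r : ℕ) : Type _ := Σ k : Fin r, (Fin (k.1 + 1) → ι)

instance (ι : Type*) [Fintype ι] (r : ℕ) : Fintype (MIdx ι r) := by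
  unfold MIdx; infer_instance

/-- Weight `|I|` of a multiindex relative to a weight function `w`. -/
def wtOf {ι : Type*} (w : ι → ℕ) {r : ℕ} (I : MIdx ι r) : ℕ := ∑ j, w (I.2 j)

/-- The iterated commutator `X_{[I]}` of a multiindex `I`. -/
def commOf {ι : Type*} (X : ι → V → V) {r : ℕ} (I : MIdx ι r) : V → V :=
  iterComm X I.1.1 I.2

/-- Standard weights: `X_0` has weight `2`, all the other fields weight `1`. -/
def wgt {n : ℕ} : Fin (n + 1) → ℕ := fun i => if i = 0 then 2 else 1

/-- Hörmander's condition of weighted step `r` on the set `S`: the commutators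
`X_{[I]}` with `|I| ≤ r` span the whole space at every point of `S`. -/
def HormSpan {ι : Type*} (X : ι → V → V) (w : ι → ℕ) (r : ℕ) (S : Set V) : Prop :=
  ∀ x ∈ S, Submodule.span ℝ {v : V | ∃ I : MIdx ι r, wtOf w I ≤ r ∧ v = commOf X I x} = ⊤

end Core

section Dist

variable {V : Type*} [NormedAddCommGroup V] [NormedSpace ℝ V] [CompleteSpace V]

/-- `φ` is an admissible curve of class `C(δ)` (for the subelliptic distance `d`)
inside `S`, joining `x` to `y`: it is an (absolutely continuous) integral of
`∑_{|I| ≤ r} a_I(t) (X_{[I]})_{φ(t)}` with `|a_I| ≤ δ^{|I|}`. -/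
def IsAdmissible {ι : Type*} [Fintype ι] {r : ℕ} (X : ι → V → V) (w : ι → ℕ)
    (S : Set V) (δ : ℝ) (x y : V) (φ : ℝ → V) : Prop :=
  ∃ a : MIdx ι r → ℝ → ℝ,
    (∀ t ∈ Icc (0:ℝ) 1, φ t ∈ S) ∧ φ 0 = x ∧ φ 1 = y ∧
    (∀ I, Measurable (a I)) ∧
    (∀ I, ∀ t ∈ Icc (0:ℝ) 1, |a I t| ≤ δ ^ wtOf w I) ∧
    (∀ I : MIdx ι r, r < wtOf w I → ∀ t, a I t = 0) ∧
    ∀ t ∈ Icc (0:ℝ) 1,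
      φ t = x + ∫ s in (0:ℝ)..t, ∑ I : MIdx ι r, a I s • commOf X I (φ s)

/-- The subelliptic (Nagel–Stein–Wainger) distance `d` attached to the system `X`. -/
def dCC {ι : Type*} [Fintype ι] (X : ι → V → V) (w : ι → ℕ) (r : ℕ)
    (S : Set V) (x y : V) : ℝ :=
  sInf {δ : ℝ | 0 < δ ∧ ∃ φ : ℝ → V, IsAdmissible (r := r) X w S δ x y φ}

/-- Metric ball of the subelliptic distance `d`. -/
def BCC {ι : Type*} [Fintype ι] (X : ι → V → V) (w : ι → ℕ) (r : ℕ)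
    (S : Set V) (x : V) (ρ : ℝ) : Set V :=
  {y | dCC X w r S x y < ρ}

/-- `φ` is an admissible curve of class `C_1(δ)` (for the control distance `d_1`)
inside `S`, joining `x` to `y`: `φ' = ∑_i a_i(t) (X_i)_{φ(t)}` with `|a_i| ≤ δ^{p_i}`. -/
def IsCtrlAdmissible {ι : Type*} [Fintype ι] (X : ι → V → V) (w : ι → ℕ)
    (S : Set V) (δ : ℝ) (x y : V) (φ : ℝ → V) : Prop :=
  ∃ a : ι → ℝ → ℝ,
    (∀ t ∈ Icc (0:ℝ) 1, φ t ∈ S) ∧ φ 0 = x ∧ φ 1 = y ∧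
    (∀ i, Measurable (a i)) ∧
    (∀ i, ∀ t ∈ Icc (0:ℝ) 1, |a i t| ≤ δ ^ w i) ∧
    ∀ t ∈ Icc (0:ℝ) 1,
      φ t = x + ∫ s in (0:ℝ)..t, ∑ i, a i s • X i (φ s)

/-- The control distance `d_1` attached to the system `X`. -/
def dCtrl {ι : Type*} [Fintype ι] (X : ι → V → V) (w : ι → ℕ)
    (S : Set V) (x y : V) : ℝ :=
  sInf {δ : ℝ | 0 < δ ∧ ∃ φ : ℝ → V, IsCtrlAdmissible X w S δ x y φ}

/-- Metric ball of the control distance `d_1`. -/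
def BCtrl {ι : Type*} [Fintype ι] (X : ι → V → V) (w : ι → ℕ)
    (S : Set V) (x : V) (ρ : ℝ) : Set V :=
  {y | dCtrl X w S x y < ρ}

/-- `x` and `y` are joined, within `W`, by a curve composed of a finite number of
arcs of integral curves of the vector fields `X_i`. -/
def IsIntegralArcChain {ι : Type*} (X : ι → V → V) (W : Set V) (x y : V) : Prop :=
  ∃ N : ℕ, ∃ z : Fin (N + 1) → V, z 0 = x ∧ z (Fin.last N) = y ∧
    ∀ j : Fin N, ∃ (i : ι) (c : ℝ) (γ : ℝ → V),
      γ 0 = z j.castSucc ∧ γ 1 = z j.succ ∧ (∀ t ∈ Icc (0:ℝ) 1, γ t ∈ W) ∧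
      ∀ t ∈ Icc (0:ℝ) 1, HasDerivAt γ (c • X i (γ t)) t

end Dist

/-- The Taylor-polynomial vector field of degree `m` centered at `x₀` which
approximates `Xi` (derivatives taken within `S`). -/
def taylorVF {p : ℕ} (Xi : E p → E p) (S : Set (E p)) (m : ℕ) (x₀ : E p) : E p → E p :=
  fun x => ∑ k ∈ Finset.range (m + 1),
    (k.factorial : ℝ)⁻¹ • iteratedFDerivWithin ℝ k Xi S x₀ (fun _ => x - x₀)

section Exp

variable {V : Type*} [NormedAddCommGroup V] [NormedSpace ℝ V] [CompleteSpace V]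

open scoped Classical in
/-- `expVF X x = exp(X)(x)`: the time-one value of an integral curve of `X`
issued from `x` (chosen by choice; under Lipschitz assumptions this is the
unique flow). -/
def expVF (X : V → V) (x : V) : V :=
  if h : ∃ φ : ℝ → V, φ 0 = x ∧ ∀ t ∈ Icc (0:ℝ) 1, φ t = x + ∫ s in (0:ℝ)..t, X (φ s)
  then h.choose 1 else x

/-- The maps `𝒞_l(t_1,…,t_l)` built from exponentials of the fields
`X_{f 0},…,X_{f k}` with independent parameters `t_0,…,t_k`. -/
def mqExp {ι : Type*} (X : ι → V → V) :
    (k : ℕ) → (Fin (k + 1) → ι) → (Fin (k + 1) → ℝ) → V → V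
  | 0, f, t => expVF (fun y => t 0 • X (f 0) y)
  | k + 1, f, t => fun x =>
      haveI : Nonempty V := ⟨0⟩
      Function.invFun (mqExp X k (fun j => f j.succ) (fun j => t j.succ))
        (expVF (fun y => (-(t 0)) • X (f 0) y)
          (mqExp X k (fun j => f j.succ) (fun j => t j.succ)
            (expVF (fun y => t 0 • X (f 0) y) x)))

/-- The iterated mixed derivative `∂^l G/∂t_1⋯∂t_l` at the origin. -/
def mixedDeriv : (l : ℕ) → ((Fin l → ℝ) → V → V) → V → V
  | 0, G => G (fun i => i.elim0)
  | l + 1, G => mixedDeriv l (fun t x => deriv (fun s : ℝ => G (Fin.cons s t) x) 0)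

/-- The quasiexponential map `C_{ℓ(I)}(t, X_I)`. -/
def qExpOf {ι : Type*} (X : ι → V → V) (w : ι → ℕ) (t : ℝ) {r : ℕ} (I : MIdx ι r) : V → V :=
  mqExp X I.1.1 I.2 (fun j => t ^ w (I.2 j))

/-- The map `E_I(t)`. -/
def Emap {ι : Type*} (X : ι → V → V) (w : ι → ℕ) {r : ℕ} (I : MIdx ι r)
    (t : ℝ) : V → V :=
  haveI : Nonempty V := ⟨0⟩
  if 0 ≤ t then qExpOf X w (Real.rpow t ((wtOf w I : ℝ))⁻¹) I
  else Function.invFun (qExpOf X w (Real.rpow |t| ((wtOf w I : ℝ))⁻¹) I)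

end Exp

/-- The map `E_η^X(x,h) = E_{I_1}(h_1) E_{I_2}(h_2) ⋯ E_{I_p}(h_p)(x)`. -/
def EmapFam {p : ℕ} {ι : Type*} {r : ℕ} (X : ι → E p → E p) (w : ι → ℕ)
    (η : Fin p → MIdx ι r) (x : E p) (h : Fin p → ℝ) : E p :=
  (List.ofFn fun j : Fin p => Emap X w (η j) (h j)).foldr (fun f y => f y) x

/-- `λ_η(x)`: the determinant of the `p × p` matrix whose rows are the
commutators `(X_{[I_j]})_x`, `I_j ∈ η`. -/
def lamDet {p : ℕ} {ι : Type*} {r : ℕ} (X : ι → E p → E p) (η : Fin p → MIdx ι r)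
    (x : E p) : ℝ :=
  Matrix.det (Matrix.of fun j k => commOf X (η j) x k)

/-- The differential operator `X_i` acting on a scalar function. -/
def Xop {p : ℕ} (Xi : E p → E p) (f : E p → ℝ) (y : E p) : ℝ := fderiv ℝ f y (Xi y)

/-- `|Xf(y)| = (∑_i |X_i f(y)|²)^{1/2}`. -/
def gradLen {p n : ℕ} (X : Fin n → E p → E p) (f : E p → ℝ) (y : E p) : ℝ :=
  Real.sqrt (∑ i, (Xop (X i) f y) ^ 2)

/-- The formal adjoint `X_i^*` acting on a scalar function:
`X_i^* f = -∑_j ∂_{y_j} (b_{ij} f)`. -/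
def XstarOp {p : ℕ} (Xi : E p → E p) (f : E p → ℝ) (y : E p) : ℝ :=
  - ∑ j, fderiv ℝ (fun z => Xi z j * f z) y (EuclideanSpace.single j 1)

section Free

/-- Left-iterated bracket in the free Lie algebra on `n` generators. -/
def freeBracket {n : ℕ} : (k : ℕ) → (Fin (k + 1) → Fin n) → FreeLieAlgebra ℝ (Fin n)
  | 0, f => FreeLieAlgebra.of ℝ (f 0)
  | k + 1, f => ⁅FreeLieAlgebra.of ℝ (f 0), freeBracket k (fun j => f j.succ)⁆

/-- The free bracket associated to a multiindex. -/
def freeBracketOf {n r : ℕ} (I : MIdx (Fin n) r) : FreeLieAlgebra ℝ (Fin n) :=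
  freeBracket I.1.1 I.2

/-- Submodule of the free Lie algebra spanned by left-iterated brackets of
length `> r`. -/
def longBrackets (n r : ℕ) : Submodule ℝ (FreeLieAlgebra ℝ (Fin n)) :=
  Submodule.span ℝ {z | ∃ k : ℕ, r ≤ k ∧ ∃ f : Fin (k + 1) → Fin n, z = freeBracket k f}

/-- The system `X` is free up to step `r` on `S`: every linear relation among
the iterated commutators of length `≤ r` at a point of `S` follows from
anticommutativity and the Jacobi identity (i.e. it already holds in the free
nilpotent Lie algebra of step `r`). -/
def FreeUpTo {V : Type*} [NormedAddCommGroup V] [NormedSpace ℝ V] {n : ℕ}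
    (X : Fin n → V → V) (r : ℕ) (S : Set V) : Prop :=
  ∀ x ∈ S, ∀ c : MIdx (Fin n) r → ℝ,
    (∑ I, c I • commOf X I x) = 0 →
    (∑ I, c I • freeBracketOf I) ∈ longBrackets n r

end Free

section ShiftAlgebra

variable {ι : Type*} {V : Type*} [NormedAddCommGroup V] [NormedSpace ℝ V]

/-- Weight of a word. -/
def wordWt (w : ι → ℕ) (l : List ι) : ℕ := (l.map w).sum

@[simp] lemma wordWt_nil (w : ι → ℕ) : wordWt w [] = 0 := rfl

@[simp] lemma wordWt_cons (w : ι → ℕ) (i : ι) (l : List ι) :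
    wordWt w (i :: l) = w i + wordWt w l := by simp [wordWt]

/-- The operator `g ↦ g (i :: ·)`, truncated to words of weight at most `m`. -/
def shiftOp (V : Type*) [NormedAddCommGroup V] [NormedSpace ℝ V]
    (w : ι → ℕ) (m : ℕ) (i : ι) : Module.End ℝ (List ι → V) where
  toFun g l := if wordWt w (i :: l) ≤ m then g (i :: l) else 0
  map_add' f g := by
    ext l
    by_cases h : wordWt w (i :: l) ≤ m <;>
      simp only [h, if_true, if_false, Pi.add_apply, add_zero]
  map_smul' c g := by
    ext l
    by_cases h : wordWt w (i :: l) ≤ m <;>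
      simp only [h, if_true, if_false, Pi.smul_apply, smul_zero, RingHom.id_apply]

lemma shiftOp_apply (w : ι → ℕ) (m : ℕ) (i : ι) (g : List ι → V) (l : List ι) :
    shiftOp V w m i g l = if wordWt w (i :: l) ≤ m then g (i :: l) else 0 := rfl

/-- An operator raises weights by at least `k` if its value at a word `l` only involves
values at words of weight at least `wordWt w l + k`. -/
def Raises (w : ι → ℕ) (k : ℕ) (S : Module.End ℝ (List ι → V)) : Prop :=
  ∀ (j : ℕ) (g : List ι → V), (∀ l, j + k ≤ wordWt w l → g l = 0) →
    ∀ l, j ≤ wordWt w l → S g l = 0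

namespace Raises

variable {w : ι → ℕ} {k k' : ℕ} {S T : Module.End ℝ (List ι → V)}

lemma mono (h : Raises w k S) (hk : k' ≤ k) : Raises w k' S :=
  fun j g hg l hl => h j g (fun l' hl' => hg l' (by omega)) l hl

lemma add (hS : Raises w k S) (hT : Raises w k T) : Raises w k (S + T) :=
  fun j g hg l hl => by simp [hS j g hg l hl, hT j g hg l hl]

lemma neg (hS : Raises w k S) : Raises w k (-S) :=
  fun j g hg l hl => by simp [hS j g hg l hl]

lemma sub (hS : Raises w k S) (hT : Raises w k T) : Raises w k (S - T) :=
  fun j g hg l hl => by simp [hS j g hg l hl, hT j g hg l hl]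

lemma smul (c : ℝ) (hS : Raises w k S) : Raises w k (c • S) :=
  fun j g hg l hl => by simp [hS j g hg l hl]

lemma mul (hS : Raises w k S) (hT : Raises w k' T) : Raises w (k + k') (S * T) := by
  intro j g hg l hl
  refine hS j (T g) (fun l' hl' => hT (j + k) g (fun l'' hl'' => hg l'' (by omega)) l' hl') l hl

lemma one : Raises w 0 (1 : Module.End ℝ (List ι → V)) :=
  fun j g hg l hl => hg l (by simpa using hl)

lemma sum {α : Type*} {s : Finset α} {F : α → Module.End ℝ (List ι → V)}
    (h : ∀ a ∈ s, Raises w k (F a)) : Raises w k (∑ a ∈ s, F a) := by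
  intro j g hg l hl
  simp only [LinearMap.sum_apply, Finset.sum_apply]
  exact Finset.sum_eq_zero fun a ha => h a ha j g hg l hl

lemma pow (hS : Raises w k S) (n : ℕ) : Raises w (n * k) (S ^ n) := by
  induction n with
  | zero => simpa using Raises.one
  | succ n ih => rw [pow_succ, add_mul, one_mul]; exact ih.mul hS

lemma shiftOp (w : ι → ℕ) (m : ℕ) (i : ι) : Raises w (w i) (shiftOp V w m i) := by
  intro j g hg l hl
  rw [shiftOp_apply, hg (i :: l) (by simp; omega), ite_self]

end Raises

lemma shiftOp_pow_eq_zero {w : ι → ℕ} (hw : ∀ i, 1 ≤ w i) (m : ℕ) (i : ι) :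
    shiftOp V w m i ^ (m + 1) = 0 := by
  have key : ∀ (k : ℕ) (g : List ι → V) (l : List ι), m < k + wordWt w l → 0 < k →
      (shiftOp V w m i ^ k) g l = 0 := by
    intro k
    induction k with
    | zero => intro g l _ h; exact absurd h (lt_irrefl 0)
    | succ k ih =>
      intro g l hl _
      rw [pow_succ', Module.End.mul_apply, shiftOp_apply]
      split_ifs with h
      · have h1 := hw i
        rw [wordWt_cons] at h
        exact ih g _ (by rw [wordWt_cons]; omega) (by omega)
      · rfl
  ext g l
  simpa using key (m + 1) g l (by omega) (by omega)

/-- The truncated exponential of `σ` times the shift. -/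
def shiftExp (V : Type*) [NormedAddCommGroup V] [NormedSpace ℝ V]
    (w : ι → ℕ) (m : ℕ) (i : ι) (σ : ℝ) : Module.End ℝ (List ι → V) :=
  ∑ j ∈ Finset.range (m + 1), ((j.factorial : ℝ)⁻¹ * σ ^ j) • shiftOp V w m i ^ j

lemma shiftExp_mul_shiftExp_neg {w : ι → ℕ} (hw : ∀ i, 1 ≤ w i) (m : ℕ) (i : ι) (σ : ℝ) :
    shiftExp V w m i σ * shiftExp V w m i (-σ) = 1 := by
  let _ : Module ℚ (Module.End ℝ (List ι → V)) := Module.compHom _ (algebraMap ℚ ℝ)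
  have key : ∀ τ : ℝ, shiftExp V w m i τ = IsNilpotent.exp (τ • shiftOp V w m i) := by
    intro τ
    have h0 : (τ • shiftOp V w m i) ^ (m + 1) = 0 := by
      rw [smul_pow, shiftOp_pow_eq_zero hw, smul_zero]
    rw [IsNilpotent.exp_eq_sum h0, shiftExp]
    refine Finset.sum_congr rfl fun j _ => ?_
    rw [smul_pow, mul_smul]
    change _ = (algebraMap ℚ ℝ ((j.factorial : ℚ)⁻¹)) • (τ ^ j • shiftOp V w m i ^ j)
    simp
  have hnil : IsNilpotent (σ • shiftOp V w m i) :=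
    ⟨m + 1, by rw [smul_pow, shiftOp_pow_eq_zero hw, smul_zero]⟩
  rw [key, key, show -σ • shiftOp V w m i = -(σ • shiftOp V w m i) by ext; simp]
  exact IsNilpotent.exp_mul_exp_neg_self hnil

/-- The truncated exponential of the shift, as an invertible operator. -/
def shiftUnit (V : Type*) [NormedAddCommGroup V] [NormedSpace ℝ V]
    {w : ι → ℕ} (hw : ∀ i, 1 ≤ w i) (m : ℕ) (i : ι) : (Module.End ℝ (List ι → V))ˣ where
  val := shiftExp V w m i 1
  inv := shiftExp V w m i (-1)
  val_inv := shiftExp_mul_shiftExp_neg hw m i 1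
  inv_val := by simpa using shiftExp_mul_shiftExp_neg (V := V) hw m i (-1)

lemma raises_shiftExp (w : ι → ℕ) (m : ℕ) (i : ι) (σ : ℝ) :
    Raises w 0 (shiftExp V w m i σ) :=
  Raises.sum fun j _ => (((Raises.shiftOp w m i).pow j).mono (Nat.zero_le _)).smul _

lemma raises_shiftExp_sub {w : ι → ℕ} (hw : ∀ i, 1 ≤ w i) {m : ℕ} (i : ι) :
    Raises w (w i + 1) (shiftExp V w m i 1 - 1 - shiftOp V w m i) := by
  have hwi := hw i
  rcases Nat.eq_zero_or_pos m with rfl | hm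
  · intro j g hg l hl
    have : ¬ wordWt w (i :: l) ≤ 0 := by rw [wordWt_cons]; omega
    simp only [shiftExp, zero_add, Finset.range_one, Finset.sum_singleton, Nat.factorial_zero,
      pow_zero, Nat.cast_one, inv_one, mul_one, one_smul, sub_self, zero_sub,
      LinearMap.neg_apply, Pi.neg_apply, shiftOp_apply, if_neg this, neg_zero]
  obtain ⟨m, rfl⟩ : ∃ m', m = m' + 1 := ⟨m - 1, by omega⟩
  have : shiftExp V w (m + 1) i 1 - 1 - shiftOp V w (m + 1) i =
      ∑ j ∈ Finset.range m, ((((j + 2).factorial : ℕ) : ℝ)⁻¹ * 1 ^ (j + 2)) •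
        shiftOp V w (m + 1) i ^ (j + 2) := by
    rw [shiftExp, Finset.sum_range_succ', Finset.sum_range_succ']
    simp only [zero_add, pow_zero, pow_one, Nat.factorial_zero, Nat.factorial_one, Nat.cast_one,
      inv_one, one_mul, one_smul, add_assoc]
    abel
  rw [this]
  refine Raises.sum fun j _ => (((Raises.shiftOp w _ i).pow (j + 2)).mono ?_).smul _
  nlinarith

/-- The operator counterpart of the iterated commutator. -/
def brOp (V : Type*) [NormedAddCommGroup V] [NormedSpace ℝ V] (w : ι → ℕ) (m : ℕ) :
    (k : ℕ) → (Fin (k + 1) → ι) → Module.End ℝ (List ι → V)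
  | 0, f => shiftOp V w m (f 0)
  | k + 1, f => brOp V w m k (fun j => f j.succ) * shiftOp V w m (f 0)
      - shiftOp V w m (f 0) * brOp V w m k (fun j => f j.succ)

/-- The group commutator which realises an iterated commutator of vector fields. -/
def brWord : (k : ℕ) → (Fin (k + 1) → ι) → FreeGroup ι
  | 0, f => FreeGroup.of (f 0)
  | k + 1, f => brWord k (fun j => f j.succ) * FreeGroup.of (f 0) *
      (brWord k (fun j => f j.succ))⁻¹ * (FreeGroup.of (f 0))⁻¹

lemma raises_brOp (w : ι → ℕ) (m k : ℕ) (f : Fin (k + 1) → ι) :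
    Raises w (∑ j, w (f j)) (brOp V w m k f) := by
  induction k with
  | zero => simpa [brOp] using Raises.shiftOp w m (f 0)
  | succ k ih =>
    rw [Fin.sum_univ_succ, brOp]
    exact (((ih fun j => f j.succ).mul (Raises.shiftOp w m (f 0))).mono (by omega)).sub
      ((Raises.shiftOp w m (f 0)).mul (ih fun j => f j.succ))

section Units

lemma commutator_sub_aux {R : Type*} [Ring R] {u v q A B : R} (h : u * v * q = 1) :
    v * u * q - 1 - (B * A - A * B) =
      (((v - 1) * (u - 1 - A) + (v - 1 - B) * A) - ((u - 1) * (v - 1 - B) + (u - 1 - A) * B)) * q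
        + (B * A - A * B) * (q - 1) := by
  nth_rewrite 1 [← h]
  noncomm_ring

variable {w : ι → ℕ} {a b : ℕ} {A B : Module.End ℝ (List ι → V)}
  {u v : (Module.End ℝ (List ι → V))ˣ}

lemma Raises.inv_sub_one (hA : Raises w a (u.val - 1)) (hu : Raises w 0 u.inv) :
    Raises w a (u.inv - 1) := by
  have : u.inv - 1 = -((u.val - 1) * u.inv) := by
    rw [sub_mul, u.val_inv, one_mul, neg_sub]
  rw [this]
  exact (hA.mul hu).neg

lemma Raises.inv_sub_one_add (ha : 1 ≤ a) (hA : Raises w a A)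
    (hu : Raises w (a + 1) (u.val - 1 - A)) (hui : Raises w 0 u.inv) :
    Raises w (a + 1) (u.inv - 1 + A) := by
  have h1 : Raises w a (u.val - 1) := by
    have := (hu.mono (Nat.le_succ a)).add hA
    rwa [sub_add_cancel] at this
  have h2 := h1.inv_sub_one hui
  have : u.inv - 1 + A = -((u.val - 1 - A) * u.inv) - A * (u.inv - 1) := by
    rw [sub_mul, sub_mul, mul_sub, u.val_inv, one_mul, mul_one]; abel
  rw [this]
  exact (hu.mul hui).neg.sub ((hA.mul h2).mono (by omega))

lemma Raises.commutator_sub (ha : 1 ≤ a) (hb : 1 ≤ b) (hA : Raises w a A) (hB : Raises w b B)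
    (hu : Raises w (a + 1) (u.val - 1 - A)) (hui : Raises w 0 u.inv)
    (hv : Raises w (b + 1) (v.val - 1 - B)) (hvi : Raises w 0 v.inv) :
    Raises w (a + b + 1) ((v * u * v⁻¹ * u⁻¹).val - 1 - (B * A - A * B)) := by
  have hu1 : Raises w a (u.val - 1) := by
    have := (hu.mono (Nat.le_succ a)).add hA
    rwa [sub_add_cancel] at this
  have hv1 : Raises w b (v.val - 1) := by
    have := (hv.mono (Nat.le_succ b)).add hB
    rwa [sub_add_cancel] at this
  have e1 : (v * u * v⁻¹ * u⁻¹).val - 1 - (B * A - A * B) =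
      (((v.val - 1) * (u.val - 1 - A) + (v.val - 1 - B) * A)
        - ((u.val - 1) * (v.val - 1 - B) + (u.val - 1 - A) * B)) * (v.inv * u.inv)
      + (B * A - A * B) * ((v.inv - 1) * u.inv + (u.inv - 1)) := by
    have e2 : (v * u * v⁻¹ * u⁻¹).val = v.val * u.val * (v.inv * u.inv) := by
      simp [mul_assoc]
    have e3 : (1 : Module.End ℝ (List ι → V)) = u.val * v.val * (v.inv * u.inv) := by
      rw [mul_assoc, ← mul_assoc v.val, v.val_inv, one_mul, u.val_inv]
    rw [e2]
    have e4 : (v.inv - 1) * u.inv + (u.inv - 1) = v.inv * u.inv - 1 := by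
      rw [sub_mul, one_mul]; abel
    rw [e4, commutator_sub_aux e3.symm]
  rw [e1]
  have c1 := (hv1.mul hu).mono (show a + b + 1 ≤ b + (a + 1) by omega)
  have c2 := (hv.mul hA).mono (show a + b + 1 ≤ b + 1 + a by omega)
  have c3 := (hu1.mul hv).mono (show a + b + 1 ≤ a + (b + 1) by omega)
  have c4 := (hu.mul hB).mono (show a + b + 1 ≤ a + 1 + b by omega)
  have d1 := (hB.mul hA).mono (show a + b ≤ b + a by omega)
  have d2 := hA.mul hB
  have d3 := ((hv1.inv_sub_one hvi).mul hui).mono (show 1 ≤ b + 0 by omega)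
  have d4 := (hu1.inv_sub_one hui).mono ha
  exact (((c1.add c2).sub (c3.add c4)).mul (hvi.mul hui)).add ((d1.sub d2).mul (d3.add d4))

end Units

lemma one_le_sum_weights {w : ι → ℕ} (hw : ∀ i, 1 ≤ w i) {k : ℕ} (f : Fin (k + 1) → ι) :
    1 ≤ ∑ j, w (f j) :=
  (hw (f 0)).trans (Finset.single_le_sum (f := fun j => w (f j)) (fun _ _ => Nat.zero_le _)
    (Finset.mem_univ 0))

lemma raises_lift_brWord {w : ι → ℕ} (hw : ∀ i, 1 ≤ w i) (m k : ℕ) (f : Fin (k + 1) → ι) :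
    Raises w 0 (FreeGroup.lift (shiftUnit V hw m) (brWord k f)).val ∧
    Raises w 0 (FreeGroup.lift (shiftUnit V hw m) (brWord k f)).inv ∧
    Raises w (∑ j, w (f j) + 1)
      ((FreeGroup.lift (shiftUnit V hw m) (brWord k f)).val - 1 - brOp V w m k f) := by
  induction k with
  | zero =>
    simp only [brWord, FreeGroup.lift_apply_of, Fin.sum_univ_succ, Fin.sum_univ_zero, add_zero,
      brOp]
    exact ⟨raises_shiftExp _ _ _ _, raises_shiftExp _ _ _ _, raises_shiftExp_sub hw _⟩
  | succ k ih =>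
    obtain ⟨h1, h2, h3⟩ := ih fun j => f j.succ
    have g1 : Raises w 0 (shiftUnit V hw m (f 0)).val := raises_shiftExp _ _ _ _
    have g2 : Raises w 0 (shiftUnit V hw m (f 0)).inv := raises_shiftExp _ _ _ _
    have g3 : Raises w (w (f 0) + 1) ((shiftUnit V hw m (f 0)).val - 1 - shiftOp V w m (f 0)) :=
      raises_shiftExp_sub hw _
    simp only [brWord, map_mul, map_inv, FreeGroup.lift_apply_of]
    refine ⟨((h1.mul g1).mul h2).mul g2, ?_, ?_⟩
    · have : ∀ a b : (Module.End ℝ (List ι → V))ˣ,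
          (a * b * a⁻¹ * b⁻¹).inv = b.val * a.val * b.inv * a.inv := by
        intro a b
        change ((a * b * a⁻¹ * b⁻¹)⁻¹).val = _
        simp [mul_assoc]
      rw [this]
      exact ((g1.mul h1).mul g2).mul h2
    · rw [Fin.sum_univ_succ, brOp]
      exact Raises.commutator_sub (hw _) (one_le_sum_weights hw _) (Raises.shiftOp _ _ _)
        (raises_brOp _ _ _ _) g3 g2 h3 h2

end ShiftAlgebra

section Jets

variable {ι : Type*} {V : Type*} [NormedAddCommGroup V] [NormedSpace ℝ V]

/-- The iterated derivative `X_{i₁} ⋯ X_{i_k} id` along a word `i₁ ⋯ i_k`. -/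
def wordField (X : ι → V → V) : List ι → V → V
  | [] => id
  | i :: l => fun x => fderiv ℝ (wordField X l) x (X i x)

/-- The derivatives of the identity along all words of weight at most `m`, rescaled by `t`. -/
def jet (X : ι → V → V) (w : ι → ℕ) (m : ℕ) (t : ℝ) (x : V) : List ι → V :=
  fun l => if wordWt w l ≤ m then t ^ wordWt w l • wordField X l x else 0

lemma jet_of_le {X : ι → V → V} {w : ι → ℕ} {m : ℕ} {l : List ι} (h : wordWt w l ≤ m)
    (t : ℝ) (x : V) : jet X w m t x l = t ^ wordWt w l • wordField X l x := if_pos h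

lemma jet_of_lt {X : ι → V → V} {w : ι → ℕ} {m : ℕ} {l : List ι} (h : m < wordWt w l)
    (t : ℝ) (x : V) : jet X w m t x l = 0 := if_neg h.not_ge

variable {X : ι → V → V} {w : ι → ℕ} {r : ℕ} {Ω : Set V}

lemma contDiffOn_wordField (hΩ : IsOpen Ω)
    (hX : ∀ i, w i ≤ r → ContDiffOn ℝ ((r - w i : ℕ)) (X i) Ω) (hw : ∀ i, 1 ≤ w i)
    (l : List ι) (hl : wordWt w l ≤ r) :
    ContDiffOn ℝ ((r - wordWt w l : ℕ)) (wordField X l) Ω := by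
  induction l with
  | nil => exact contDiff_id.contDiffOn
  | cons i l ih =>
    rw [wordWt_cons] at hl ⊢
    have hwi := hw i
    have h1 := (ih (by omega)).fderiv_of_isOpen (m := ((r - (w i + wordWt w l) : ℕ))) hΩ
      (by exact_mod_cast (by omega : r - (w i + wordWt w l) + 1 ≤ r - wordWt w l))
    exact h1.clm_apply ((hX i (by omega)).of_le (by exact_mod_cast (by omega)))

lemma contDiffOn_iterComm (hΩ : IsOpen Ω)
    (hX : ∀ i, w i ≤ r → ContDiffOn ℝ ((r - w i : ℕ)) (X i) Ω) (hw : ∀ i, 1 ≤ w i)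
    (k : ℕ) (f : Fin (k + 1) → ι) (hf : ∑ j, w (f j) ≤ r) :
    ContDiffOn ℝ ((r - ∑ j, w (f j) : ℕ)) (iterComm X k f) Ω := by
  induction k with
  | zero =>
    simp only [Fin.sum_univ_succ, Fin.sum_univ_zero, add_zero] at hf ⊢
    exact hX _ hf
  | succ k ih =>
    rw [Fin.sum_univ_succ] at hf ⊢
    have h0 := hw (f 0)
    have h1 := one_le_sum_weights hw (fun j => f j.succ)
    have hY := ih (fun j => f j.succ) (by omega)
    have hX0 := hX (f 0) (by omega)
    set b := ∑ j, w ((fun j => f (Fin.succ j)) j) with hb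
    have d1 := hY.fderiv_of_isOpen (m := ((r - (w (f 0) + b) : ℕ))) hΩ
      (by exact_mod_cast (by omega))
    have d2 := hX0.fderiv_of_isOpen (m := ((r - (w (f 0) + b) : ℕ))) hΩ
      (by exact_mod_cast (by omega))
    exact (d1.clm_apply (hX0.of_le (by exact_mod_cast (by omega)))).sub
      (d2.clm_apply (hY.of_le (by exact_mod_cast (by omega))))

lemma hasDerivAt_shiftOp (w : ι → ℕ) (m : ℕ) (i : ι) {G : ℝ → List ι → V} {G' : List ι → V}
    {s₀ : ℝ} (l : List ι) (h : HasDerivAt (fun s => G s (i :: l)) (G' (i :: l)) s₀) :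
    HasDerivAt (fun s => shiftOp V w m i (G s) l) (shiftOp V w m i G' l) s₀ := by
  simp only [shiftOp_apply]
  split_ifs
  · exact h
  · exact hasDerivAt_const _ _

lemma hasDerivAt_brOp (w : ι → ℕ) (m k : ℕ) (f : Fin (k + 1) → ι) {G : ℝ → List ι → V}
    {G' : List ι → V} {s₀ : ℝ} (l : List ι)
    (h : ∀ l', wordWt w l' ≤ wordWt w l + ∑ j, w (f j) →
      HasDerivAt (fun s => G s l') (G' l') s₀) :
    HasDerivAt (fun s => brOp V w m k f (G s) l) (brOp V w m k f G' l) s₀ := by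
  induction k generalizing G G' l with
  | zero =>
    refine hasDerivAt_shiftOp w m (f 0) l (h _ ?_)
    simp [add_comm]
  | succ k ih =>
    rw [Fin.sum_univ_succ] at h
    simp only [brOp, LinearMap.sub_apply, Module.End.mul_apply, Pi.sub_apply]
    refine HasDerivAt.sub (ih _ l fun l' hl' => hasDerivAt_shiftOp w m (f 0) l' (h _ ?_))
      (hasDerivAt_shiftOp w m (f 0) l (ih _ _ fun l' hl' => h _ ?_))
    · rw [wordWt_cons]; omega
    · rw [wordWt_cons] at hl'; omega

lemma shiftOp_jet {m : ℕ} (i : ι) (t : ℝ) (x : V) {l : List ι} (hl : w i + wordWt w l ≤ m) :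
    shiftOp V w m i (jet X w m t x) l =
      t ^ (w i + wordWt w l) • fderiv ℝ (wordField X l) x (X i x) := by
  have hl' : wordWt w (i :: l) ≤ m := by rwa [wordWt_cons]
  rw [shiftOp_apply, if_pos hl', jet_of_le hl', wordWt_cons]
  rfl

lemma fderiv_fderiv_apply {F Y : V → V} {x : V} (hF : DifferentiableAt ℝ (fderiv ℝ F) x)
    (hY : DifferentiableAt ℝ Y x) (v : V) :
    fderiv ℝ (fun y => fderiv ℝ F y (Y y)) x v =
      fderiv ℝ (fderiv ℝ F) x v (Y x) + fderiv ℝ F x (fderiv ℝ Y x v) := by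
  rw [(hF.hasFDerivAt.clm_apply hY.hasFDerivAt).fderiv]
  simp [add_comm]

lemma hasDerivAt_fderiv_apply {F Y : V → V} {x : V} (hF : DifferentiableAt ℝ (fderiv ℝ F) x)
    (hY : DifferentiableAt ℝ Y x) (v : V) :
    HasDerivAt (fun s : ℝ => fderiv ℝ F (x + s • v) (Y (x + s • v)))
      (fderiv ℝ (fderiv ℝ F) x v (Y x) + fderiv ℝ F x (fderiv ℝ Y x v)) 0 := by
  rw [← fderiv_fderiv_apply hF hY]
  exact (hF.clm_apply hY).hasFDerivAt.hasLineDerivAt v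

/-- The operator `brOp` acts on jets as the iterated commutator. -/
lemma brOp_jet (hΩ : IsOpen Ω)
    (hX : ∀ i, w i ≤ r → ContDiffOn ℝ ((r - w i : ℕ)) (X i) Ω) (hw : ∀ i, 1 ≤ w i)
    {m : ℕ} (hm : m ≤ r) (t : ℝ) (k : ℕ) (f : Fin (k + 1) → ι) (l : List ι)
    (hl : ∑ j, w (f j) + wordWt w l ≤ m) {x : V} (hx : x ∈ Ω) :
    brOp V w m k f (jet X w m t x) l =
      t ^ (∑ j, w (f j) + wordWt w l) • fderiv ℝ (wordField X l) x (iterComm X k f x) := by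
  induction k generalizing l x with
  | zero =>
    simp only [Fin.sum_univ_succ, Fin.sum_univ_zero, add_zero] at hl ⊢
    exact shiftOp_jet _ _ _ hl
  | succ k ih =>
    rw [Fin.sum_univ_succ] at hl ⊢
    have h0 := hw (f 0)
    have h1 := one_le_sum_weights hw (fun j => f j.succ)
    have hYC := contDiffOn_iterComm hΩ hX hw k (fun j => f j.succ)
    have IH := ih (fun j => f j.succ)
    set Y := iterComm X k (fun j => f j.succ) with hY
    set b := ∑ j, w ((fun j => f (Fin.succ j)) j) with hb
    set i := f 0 with hi
    set F := wordField X l with hF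
    have hnhds := hΩ.mem_nhds hx
    have hFC : ContDiffAt ℝ 2 F x :=
      ((contDiffOn_wordField hΩ hX hw l (by omega)).of_le
        (by exact_mod_cast (by omega : 2 ≤ r - wordWt w l))).contDiffAt hnhds
    have hYd : DifferentiableAt ℝ Y x :=
      ((hYC (by omega)).contDiffAt hnhds).differentiableAt
        (by exact_mod_cast (by omega : r - b ≠ 0))
    have hXd : DifferentiableAt ℝ (X i) x :=
      ((hX i (by omega)).contDiffAt hnhds).differentiableAt
        (by exact_mod_cast (by omega : r - w i ≠ 0))
    have hF' : DifferentiableAt ℝ (fderiv ℝ F) x :=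
      (hFC.fderiv_right (m := 1) (by norm_num)).differentiableAt (by norm_num)
    have hsymm : ∀ a c, fderiv ℝ (fderiv ℝ F) x a c = fderiv ℝ (fderiv ℝ F) x c a :=
      fun a c => (hFC.isSymmSndFDerivAt (by simp)).eq a c
    have hfirst : brOp V w m k (fun j => f j.succ) (shiftOp V w m i (jet X w m t x)) l =
        t ^ (w i + b + wordWt w l) •
          (fderiv ℝ (fderiv ℝ F) x (X i x) (Y x) + fderiv ℝ F x (fderiv ℝ Y x (X i x))) := by
      have e1 : HasDerivAt (fun s : ℝ => brOp V w m k (fun j => f j.succ)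
            (t ^ w i • jet X w m t (x + s • X i x)) l)
          (brOp V w m k (fun j => f j.succ) (shiftOp V w m i (jet X w m t x)) l) 0 := by
        refine hasDerivAt_brOp w m k _ l fun l' hl' => ?_
        change wordWt w l' ≤ wordWt w l + b at hl'
        have hl'' : wordWt w l' + w i ≤ m := by omega
        have hWd : DifferentiableAt ℝ (wordField X l') x :=
          ((contDiffOn_wordField hΩ hX hw l' (by omega)).contDiffAt hnhds).differentiableAt
            (by exact_mod_cast (by omega : r - wordWt w l' ≠ 0))
        rw [shiftOp_jet _ _ _ (by omega)]
        simp only [Pi.smul_apply, jet_of_le (show wordWt w l' ≤ m by omega), smul_smul, pow_add]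
        refine HasDerivAt.const_smul _ ?_
        exact hWd.hasFDerivAt.hasLineDerivAt (X i x)
      have e2 : HasDerivAt (fun s : ℝ => t ^ (w i + b + wordWt w l) •
            fderiv ℝ F (x + s • X i x) (Y (x + s • X i x)))
          (t ^ (w i + b + wordWt w l) •
            (fderiv ℝ (fderiv ℝ F) x (X i x) (Y x) + fderiv ℝ F x (fderiv ℝ Y x (X i x)))) 0 := by
        exact (hasDerivAt_fderiv_apply hF' hYd (X i x)).const_smul _
      refine e1.unique (e2.congr_of_eventuallyEq ?_)
      have hmem : ∀ᶠ s : ℝ in 𝓝 0, x + s • X i x ∈ Ω :=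
        (by fun_prop : Continuous fun s : ℝ => x + s • X i x).continuousAt.eventually_mem
          (by simpa using hnhds)
      filter_upwards [hmem] with s hs
      rw [map_smul, Pi.smul_apply, IH l (by omega) hs, smul_smul, ← pow_add, ← add_assoc]
    have hsecond : brOp V w m k (fun j => f j.succ) (jet X w m t x) (i :: l) =
        t ^ (w i + b + wordWt w l) •
          (fderiv ℝ (fderiv ℝ F) x (Y x) (X i x) + fderiv ℝ F x (fderiv ℝ (X i) x (Y x))) := by
      rw [IH (i :: l) (by rw [wordWt_cons]; omega) hx, wordWt_cons]
      have : fderiv ℝ (wordField X (i :: l)) x (Y x) =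
          fderiv ℝ (fderiv ℝ F) x (Y x) (X i x) + fderiv ℝ F x (fderiv ℝ (X i) x (Y x)) := by
        exact fderiv_fderiv_apply hF' hXd (Y x)
      rw [this]
      congr 2
      omega
    have hle : wordWt w (i :: l) ≤ m := by rw [wordWt_cons]; omega
    rw [brOp, LinearMap.sub_apply, Pi.sub_apply, Module.End.mul_apply, Module.End.mul_apply,
      hfirst, shiftOp_apply, if_pos hle, hsecond, ← smul_sub, hsymm]
    congr 1
    simp only [iterComm, vComm, map_sub]
    abel

end Jets

section Steering

variable {ι : Type*} [Fintype ι] {V : Type*} [NormedAddCommGroup V] [NormedSpace ℝ V]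

/-- `y` is reached from `x` by a continuous admissible curve of class `C_1(δ)` in `Ω`. -/
def Steer (X : ι → V → V) (w : ι → ℕ) (Ω : Set V) (δ : ℝ) (x y : V) : Prop :=
  ∃ φ : ℝ → V, ContinuousOn φ (Icc 0 1) ∧ IsCtrlAdmissible X w Ω δ x y φ

variable {X : ι → V → V} {w : ι → ℕ} {Ω : Set V} {δ δ' M : ℝ} {x y z : V}

lemma aestronglyMeasurable_control (hX : ∀ i, ContinuousOn (X i) Ω) {φ : ℝ → V}
    {a : ι → ℝ → ℝ} {c d : ℝ} (hφ : ContinuousOn φ (Icc c d)) (hφΩ : ∀ t ∈ Icc c d, φ t ∈ Ω)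
    (ha : ∀ i, Measurable (a i)) :
    AEStronglyMeasurable (fun s => ∑ i, a i s • X i (φ s)) (volume.restrict (Icc c d)) := by
  refine Finset.aestronglyMeasurable_fun_sum _ fun i _ => ?_
  exact (ha i).aestronglyMeasurable.smul
    (((hX i).comp hφ hφΩ).aestronglyMeasurable measurableSet_Icc)

lemma norm_control_le (hδ : 0 ≤ δ) (hM : ∀ i, ∀ x ∈ Ω, ‖X i x‖ ≤ M) {c : ι → ℝ}
    (hc : ∀ i, |c i| ≤ δ ^ w i) (hx : x ∈ Ω) :
    ‖∑ i, c i • X i x‖ ≤ ∑ i, δ ^ w i * M := by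
  refine norm_sum_le_of_le _ fun i _ => ?_
  rw [norm_smul, Real.norm_eq_abs]
  exact mul_le_mul (hc i) (hM i x hx) (norm_nonneg _) (by positivity)

lemma intervalIntegrable_control (hδ : 0 ≤ δ) (hM : ∀ i, ∀ x ∈ Ω, ‖X i x‖ ≤ M) {φ : ℝ → V}
    {a : ι → ℝ → ℝ} (hφΩ : ∀ t ∈ Icc (0 : ℝ) 1, φ t ∈ Ω)
    (hb : ∀ i, ∀ t ∈ Icc (0:ℝ) 1, |a i t| ≤ δ ^ w i)
    (hm : AEStronglyMeasurable (fun s => ∑ i, a i s • X i (φ s)) (volume.restrict (Icc 0 1))) :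
    IntervalIntegrable (fun s => ∑ i, a i s • X i (φ s)) volume 0 1 := by
  rw [intervalIntegrable_iff_integrableOn_Icc_of_le zero_le_one]
  refine Integrable.of_bound hm (∑ i, δ ^ w i * M) ?_
  filter_upwards [ae_restrict_mem measurableSet_Icc] with t ht
  exact norm_control_le hδ hM (fun i => hb i t ht) (hφΩ t ht)

lemma Steer.mono (h : Steer X w Ω δ x y) (hδ : 0 ≤ δ) (hδ' : δ ≤ δ') : Steer X w Ω δ' x y := by
  obtain ⟨φ, hφ, a, h1, h2, h3, h4, h5, h6⟩ := h
  exact ⟨φ, hφ, a, h1, h2, h3, h4,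
    fun i t ht => (h5 i t ht).trans (pow_le_pow_left₀ hδ hδ' _), h6⟩

lemma Steer.refl (hδ : 0 ≤ δ) (hx : x ∈ Ω) : Steer X w Ω δ x x := by
  refine ⟨fun _ => x, continuousOn_const, fun _ _ => 0, fun _ _ => hx, rfl, rfl,
    fun _ => measurable_const, fun i t _ => ?_, fun t _ => by simp⟩
  simpa using pow_nonneg hδ _

lemma Steer.mem_right (h : Steer X w Ω δ x y) : y ∈ Ω := by
  obtain ⟨φ, hφ, a, h1, h2, h3, -⟩ := h
  exact h3 ▸ h1 1 (by simp)

lemma Steer.symm (hδ : 0 ≤ δ) (hX : ∀ i, ContinuousOn (X i) Ω)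
    (hM : ∀ i, ∀ x ∈ Ω, ‖X i x‖ ≤ M) (h : Steer X w Ω δ x y) : Steer X w Ω δ y x := by
  obtain ⟨φ, hφ, a, h1, h2, h3, h4, h5, h6⟩ := h
  have hrev : ∀ t ∈ Icc (0 : ℝ) 1, 1 - t ∈ Icc (0 : ℝ) 1 := fun t ht =>
    ⟨by linarith [ht.2], by linarith [ht.1]⟩
  have hinteg := intervalIntegrable_control hδ hM h1 h5 (aestronglyMeasurable_control hX hφ h1 h4)
  refine ⟨fun t => φ (1 - t), hφ.comp (by fun_prop) hrev, fun i t => -a i (1 - t),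
    fun t ht => h1 _ (hrev t ht), by simpa, by simpa,
    fun i => ((h4 i).comp (measurable_const.sub measurable_id)).neg,
    fun i t ht => by simpa using h5 i _ (hrev t ht), fun t ht => ?_⟩
  have e1 : (∫ s in (0:ℝ)..t, ∑ i, (-a i (1 - s)) • X i (φ (1 - s))) =
      -∫ s in (1 - t)..1, ∑ i, a i s • X i (φ s) := by
    have := intervalIntegral.integral_comp_sub_left (a := 0) (b := t)
      (fun s => ∑ i, a i s • X i (φ s)) 1
    rw [sub_zero] at this
    rw [← this, ← intervalIntegral.integral_neg]
    simp
  have hsub : ∀ t ∈ Icc (0 : ℝ) 1, IntervalIntegrable (fun s => ∑ i, a i s • X i (φ s))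
      volume 0 t := fun t ht => hinteg.mono_set (by
    rw [uIcc_of_le ht.1, uIcc_of_le zero_le_one]; exact Icc_subset_Icc le_rfl ht.2)
  have e2 := intervalIntegral.integral_interval_sub_left hinteg (hsub _ (hrev t ht))
  have hy := h6 1 (by simp)
  rw [h3] at hy
  change φ (1 - t) = _
  rw [e1, ← e2, h6 _ (hrev t ht), hy]
  abel

lemma Steer.of_arc [CompleteSpace V] (hX : ∀ i, ContinuousOn (X i) Ω) [DecidableEq ι]
    {i : ι} {α : ℝ → V} {σ t : ℝ} (ht : 0 < t)
    (hσ : |σ| ≤ 1) (hα : ∀ s ∈ Icc 0 (t ^ w i), HasDerivWithinAt α (σ • X i (α s))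
      (Icc 0 (t ^ w i)) s) (hαΩ : ∀ s ∈ Icc 0 (t ^ w i), α s ∈ Ω) :
    Steer X w Ω t (α 0) (α (t ^ w i)) := by
  set τ := t ^ w i with hτ
  have hτ0 : 0 < τ := by positivity
  have hmaps : ∀ s ∈ Icc (0 : ℝ) 1, τ * s ∈ Icc 0 τ := fun s hs =>
    ⟨mul_nonneg hτ0.le hs.1, mul_le_of_le_one_right hτ0.le hs.2⟩
  have hαc : ContinuousOn α (Icc 0 τ) := fun s hs => (hα s hs).continuousWithinAt
  have hφc : ContinuousOn (fun s => α (τ * s)) (Icc 0 1) :=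
    hαc.comp (by fun_prop) hmaps
  refine ⟨fun s => α (τ * s), hφc, fun j _ => if j = i then σ * τ else 0,
    fun s hs => hαΩ _ (hmaps s hs), by simp, by simp, fun _ => measurable_const,
    fun j s _ => ?_, fun s hs => ?_⟩
  · by_cases hj : j = i
    · subst hj
      simp only [if_true, abs_mul, abs_of_pos hτ0, ← hτ]
      exact mul_le_of_le_one_left hτ0.le hσ
    · simpa [hj] using pow_nonneg ht.le _
  · have hd : ∀ u ∈ Ioo 0 s, HasDerivAt (fun u => α (τ * u))
        ((σ * τ) • X i (α (τ * u))) u := by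
      intro u hu
      have hu1 : u < 1 := hu.2.trans_le hs.2
      have hmem : τ * u ∈ Ioo 0 τ := ⟨mul_pos hτ0 hu.1, mul_lt_of_lt_one_right hτ0 hu1⟩
      have h1 := (hα (τ * u) (Ioo_subset_Icc_self hmem)).hasDerivAt (Icc_mem_nhds hmem.1 hmem.2)
      have h2 := h1.scomp u ((hasDerivAt_id u).const_mul τ)
      rw [mul_one, smul_smul, mul_comm τ] at h2
      exact h2
    have hc : ContinuousOn (fun u => (σ * τ) • X i (α (τ * u))) (Icc 0 s) :=
      (((hX i).comp hφc fun u hu => hαΩ _ (hmaps u hu)).mono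
        (Icc_subset_Icc le_rfl hs.2)).const_smul _
    have := intervalIntegral.integral_eq_sub_of_hasDerivAt_of_le hs.1
      (hφc.mono (Icc_subset_Icc le_rfl hs.2)) hd
      (by apply ContinuousOn.intervalIntegrable; rwa [uIcc_of_le hs.1])
    simp only [ite_smul, zero_smul, Finset.sum_ite_eq', Finset.mem_univ, if_true]
    rw [this, mul_zero, add_sub_cancel]

end Steering

section InfiniteConcatenation

/-- The starting time of the `k`-th dyadic piece of `[0, 1)`. -/
def dyTime (k : ℕ) : ℝ := 1 - (1 / 2) ^ k

/-- The index of the dyadic piece of `[0, 1)` containing `t`. -/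
def dyIdx (t : ℝ) : ℕ := ⌊Real.logb 2 (1 - t)⁻¹⌋₊

lemma dyTime_zero : dyTime 0 = 0 := by simp [dyTime]

lemma dyTime_lt_one (k : ℕ) : dyTime k < 1 := by simp [dyTime]

lemma dyTime_le_succ (k : ℕ) : dyTime k ≤ dyTime (k + 1) := by
  have : (0 : ℝ) < (1 / 2) ^ k := by positivity
  simp only [dyTime, pow_succ]; linarith

lemma dyTime_nonneg (k : ℕ) : 0 ≤ dyTime k := by
  have : ((1 : ℝ) / 2) ^ k ≤ 1 := pow_le_one₀ (by norm_num) (by norm_num)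
  simp only [dyTime]; linarith

lemma two_pow_mul_dyTime_succ (k : ℕ) :
    2 ^ (k + 1) * dyTime (k + 1) - 2 ^ (k + 1) * dyTime k = 1 := by
  have : (2 : ℝ) ^ k * (1 / 2) ^ k = 1 := by rw [← mul_pow]; norm_num
  simp only [dyTime, pow_succ]
  linear_combination this

lemma tendsto_dyTime : Filter.Tendsto dyTime Filter.atTop (𝓝 1) := by
  have := (tendsto_pow_atTop_nhds_zero_of_lt_one (r := (1 : ℝ) / 2)
    (by norm_num) (by norm_num)).const_sub 1
  rw [sub_zero] at this
  exact this

lemma le_dyTime_iff {t : ℝ} (ht : t < 1) (k : ℕ) :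
    dyTime k ≤ t ↔ (k : ℝ) ≤ Real.logb 2 (1 - t)⁻¹ := by
  have h1 : 0 < 1 - t := by linarith
  rw [Real.le_logb_iff_rpow_le (by norm_num) (by positivity), Real.rpow_natCast, dyTime,
    le_inv_comm₀ (by positivity) h1, one_div, inv_pow]
  constructor <;> intro h <;> linarith

lemma dyIdx_spec {t : ℝ} (ht0 : 0 ≤ t) (ht : t < 1) :
    t ∈ Ico (dyTime (dyIdx t)) (dyTime (dyIdx t + 1)) := by
  have h0 : 0 ≤ Real.logb 2 (1 - t)⁻¹ := by
    simpa using (le_dyTime_iff ht 0).1 (by rwa [dyTime_zero])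
  refine ⟨(le_dyTime_iff ht _).2 (Nat.floor_le h0), ?_⟩
  by_contra hcon
  have := (le_dyTime_iff ht _).1 (not_lt.1 hcon)
  push_cast at this
  exact absurd (Nat.lt_floor_add_one (Real.logb 2 (1 - t)⁻¹)) (not_lt.2 this)

lemma dyIdx_eq {t : ℝ} {k : ℕ} (ht : t ∈ Ico (dyTime k) (dyTime (k + 1))) : dyIdx t = k := by
  have ht1 : t < 1 := ht.2.trans (dyTime_lt_one _)
  have h1 := (le_dyTime_iff ht1 k).1 ht.1
  have h2 : ¬ ((k + 1 : ℕ) : ℝ) ≤ Real.logb 2 (1 - t)⁻¹ := fun h =>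
    absurd ((le_dyTime_iff ht1 (k + 1)).2 h) (not_le.2 ht.2)
  rw [dyIdx, Nat.floor_eq_iff ((Nat.cast_nonneg k).trans h1)]
  push_cast at h2
  exact ⟨h1, not_le.1 h2⟩

lemma measurable_dyIdx : Measurable dyIdx := by
  unfold dyIdx
  exact ((Real.measurable_log.comp ((measurable_const.sub measurable_id).inv)).div_const
    _).nat_floor

lemma iUnion_dyTime : ⋃ k, Icc (dyTime k) (dyTime (k + 1)) = Ico 0 1 := by
  ext t
  simp only [mem_iUnion]
  constructor
  · rintro ⟨k, hk⟩
    exact ⟨(dyTime_nonneg k).trans hk.1, hk.2.trans_lt (dyTime_lt_one _)⟩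
  · exact fun ht => ⟨dyIdx t, Ico_subset_Icc_self (dyIdx_spec ht.1 ht.2)⟩

variable {ι : Type*} [Fintype ι] {V : Type*} [NormedAddCommGroup V] [NormedSpace ℝ V]
  {X : ι → V → V} {w : ι → ℕ} {Ω : Set V} {δ M : ℝ} {x y z : V}

/-- Infinitely many admissible curves of geometrically decreasing size can be concatenated. -/
lemma Steer.of_seq (hw : ∀ i, 1 ≤ w i) (hδ : 0 ≤ δ) (hX : ∀ i, ContinuousOn (X i) Ω)
    (hM : ∀ i, ∀ x ∈ Ω, ‖X i x‖ ≤ M) {x : ℕ → V} (hy : y ∈ Ω)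
    (hxy : Filter.Tendsto x Filter.atTop (𝓝 y))
    (h : ∀ k, Steer X w Ω (δ * (1 / 2) ^ (k + 1)) (x k) (x (k + 1))) :
    Steer X w Ω δ (x 0) y := by
  choose φ hφ a h1 h2 h3 h4 h5 h6 using h
  let ψ : ℕ → ℝ → ℝ := fun k t => 2 ^ (k + 1) * t - 2 ^ (k + 1) * dyTime k
  have hψc : ∀ k, Continuous (ψ k) := fun k => by fun_prop
  have hψ0 : ∀ k, ψ k (dyTime k) = 0 := fun k => sub_self _
  have hψ1 : ∀ k, ψ k (dyTime (k + 1)) = 1 := two_pow_mul_dyTime_succ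
  have hψm : ∀ k, Monotone (ψ k) := fun k s t hst => by
    simp only [ψ]; gcongr
  have hψmem : ∀ k, ∀ t ∈ Icc (dyTime k) (dyTime (k + 1)), ψ k t ∈ Icc (0 : ℝ) 1 :=
    fun k t ht => ⟨hψ0 k ▸ hψm k ht.1, hψ1 k ▸ hψm k ht.2⟩
  let Φ : ℝ → V := fun t => if t = 1 then y else φ (dyIdx t) (ψ (dyIdx t) t)
  let A : ι → ℝ → ℝ := fun i t =>
    if t = 1 then 0 else 2 ^ (dyIdx t + 1) * a (dyIdx t) i (ψ (dyIdx t) t)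
  have hΦ1 : Φ 1 = y := if_pos rfl
  have hΦ' : ∀ k, ∀ t ∈ Ico (dyTime k) (dyTime (k + 1)), Φ t = φ k (ψ k t) := by
    intro k t ht
    have : t ≠ 1 := (ht.2.trans (dyTime_lt_one _)).ne
    simp only [Φ, if_neg this, dyIdx_eq ht]
  have hstep : ∀ k, dyTime k < dyTime (k + 1) := by
    intro k
    refine lt_of_le_of_ne (dyTime_le_succ k) fun he => ?_
    have := hψ1 k
    rw [← he, hψ0] at this
    exact zero_ne_one this
  have hΦ : ∀ k, ∀ t ∈ Icc (dyTime k) (dyTime (k + 1)), Φ t = φ k (ψ k t) := by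
    intro k t ht
    rcases ht.2.lt_or_eq with hlt | rfl
    · exact hΦ' k t ⟨ht.1, hlt⟩
    · rw [hΦ' (k + 1) _ ⟨le_rfl, hstep _⟩, hψ0, hψ1, h2, h3]
  have hA : ∀ i k, ∀ t ∈ Ico (dyTime k) (dyTime (k + 1)),
      A i t = 2 ^ (k + 1) * a k i (ψ k t) := by
    intro i k t ht
    have : t ≠ 1 := (ht.2.trans (dyTime_lt_one _)).ne
    simp only [A, if_neg this, dyIdx_eq ht]
  have hAm : ∀ i, Measurable (A i) := by
    intro i
    have hpair : Measurable fun q : ℕ × ℝ => (2 : ℝ) ^ (q.1 + 1) * a q.1 i (ψ q.1 q.2) :=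
      measurable_from_prod_countable_right fun k =>
        ((h4 k i).comp (hψc k).measurable).const_mul ((2 : ℝ) ^ (k + 1))
    exact Measurable.ite (measurableSet_singleton 1) measurable_const
      (hpair.comp (measurable_dyIdx.prodMk measurable_id))
  have hΦΩ : ∀ t ∈ Icc (0 : ℝ) 1, Φ t ∈ Ω := by
    intro t ht
    rcases ht.2.lt_or_eq with hlt | rfl
    · have hs := dyIdx_spec ht.1 hlt
      rw [hΦ' _ t hs]
      exact h1 _ _ (hψmem _ _ (Ico_subset_Icc_self hs))
    · rwa [hΦ1]
  have hAb : ∀ i, ∀ t ∈ Icc (0 : ℝ) 1, |A i t| ≤ δ ^ w i := by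
    intro i t ht
    rcases ht.2.lt_or_eq with hlt | rfl
    · have hs := dyIdx_spec ht.1 hlt
      have hb := h5 (dyIdx t) i _ (hψmem _ _ (Ico_subset_Icc_self hs))
      rw [hA i _ t hs, abs_mul, abs_of_pos (by positivity : (0 : ℝ) < 2 ^ (dyIdx t + 1))]
      calc (2 : ℝ) ^ (dyIdx t + 1) * |a (dyIdx t) i (ψ (dyIdx t) t)|
          ≤ 2 ^ (dyIdx t + 1) * (δ * (1 / 2) ^ (dyIdx t + 1)) ^ w i := by gcongr
        _ = δ ^ w i * (2 ^ (dyIdx t + 1) * ((1 / 2) ^ (dyIdx t + 1)) ^ w i) := by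
            rw [mul_pow]; ring
        _ ≤ δ ^ w i * (2 ^ (dyIdx t + 1) * (1 / 2) ^ (dyIdx t + 1)) := by
            gcongr
            exact pow_le_of_le_one (by positivity)
              (pow_le_one₀ (by norm_num) (by norm_num)) (by have := hw i; omega)
        _ = δ ^ w i := by rw [← mul_pow]; norm_num
    · simpa [A] using pow_nonneg hδ _
  have hmeas : AEStronglyMeasurable (fun s => ∑ i, A i s • X i (Φ s))
      (volume.restrict (Icc 0 1)) := by
    rw [← restrict_Ico_eq_restrict_Icc, ← iUnion_dyTime, aestronglyMeasurable_iUnion_iff]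
    intro k
    refine aestronglyMeasurable_control hX ?_ (fun t ht => hΦΩ t
      ⟨(dyTime_nonneg k).trans ht.1, ht.2.trans (dyTime_lt_one _).le⟩) hAm
    exact ((hφ k).comp (hψc k).continuousOn (hψmem k)).congr (hΦ k)
  have hinteg := intervalIntegrable_control hδ hM hΦΩ hAb hmeas
  have hsub : ∀ {c d : ℝ}, 0 ≤ c → c ≤ d → d ≤ 1 →
      IntervalIntegrable (fun s => ∑ i, A i s • X i (Φ s)) volume c d := by
    intro c d hc hcd hd
    refine hinteg.mono_set ?_
    rw [uIcc_of_le hcd, uIcc_of_le zero_le_one]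
    exact Icc_subset_Icc hc hd
  have hpiece : ∀ k, ∀ t ∈ Icc (dyTime k) (dyTime (k + 1)),
      (∫ s in (dyTime k)..t, ∑ i, A i s • X i (Φ s)) = Φ t - x k := by
    intro k t ht
    have e1 : (∫ s in (dyTime k)..t, ∑ i, A i s • X i (Φ s)) =
        ∫ s in (dyTime k)..t, (2 : ℝ) ^ (k + 1) • ∑ i, a k i (ψ k s) • X i (φ k (ψ k s)) := by
      refine intervalIntegral.integral_congr_uIoo fun s hs => ?_
      rw [uIoo_of_le ht.1] at hs
      have hs' : s ∈ Ico (dyTime k) (dyTime (k + 1)) := ⟨hs.1.le, hs.2.trans_le ht.2⟩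
      simp only [hΦ' k s hs', hA _ k s hs', Finset.smul_sum, smul_smul]
    have e2 := intervalIntegral.smul_integral_comp_mul_sub (a := dyTime k) (b := t)
      (fun s => ∑ i, a k i s • X i (φ k s)) (2 ^ (k + 1)) (2 ^ (k + 1) * dyTime k)
    rw [e1, intervalIntegral.integral_smul, e2, sub_self, hΦ k t ht, h6 k _ (hψmem k t ht),
      add_sub_cancel_left]
  have hgrid : ∀ k, (∫ s in (0 : ℝ)..(dyTime k), ∑ i, A i s • X i (Φ s)) = x k - x 0 := by
    intro k
    induction k with
    | zero => simp [dyTime_zero]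
    | succ k ih =>
      have hk : dyTime (k + 1) ∈ Icc (dyTime k) (dyTime (k + 1)) := ⟨dyTime_le_succ k, le_rfl⟩
      rw [← intervalIntegral.integral_add_adjacent_intervals
        (hsub le_rfl (dyTime_nonneg k) (dyTime_lt_one k).le)
        (hsub (dyTime_nonneg k) (dyTime_le_succ k) (dyTime_lt_one _).le), ih,
        hpiece k _ hk, hΦ k _ hk, hψ1, h3]
      abel
  have hprim : ContinuousOn (fun t => ∫ s in (0 : ℝ)..t, ∑ i, A i s • X i (Φ s)) (Icc 0 1) := by
    have := intervalIntegral.continuousOn_primitive_interval' hinteg left_mem_uIcc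
    rwa [uIcc_of_le zero_le_one] at this
  have heq : ∀ t ∈ Icc (0 : ℝ) 1, Φ t = x 0 + ∫ s in (0 : ℝ)..t, ∑ i, A i s • X i (Φ s) := by
    intro t ht
    rcases ht.2.lt_or_eq with hlt | rfl
    · have hs := Ico_subset_Icc_self (dyIdx_spec ht.1 hlt)
      rw [← intervalIntegral.integral_add_adjacent_intervals
        (hsub le_rfl (dyTime_nonneg (dyIdx t)) (dyTime_lt_one _).le)
        (hsub (dyTime_nonneg (dyIdx t)) hs.1 ht.2), hgrid, hpiece _ t hs]
      abel
    · have hlim : Filter.Tendsto (fun k => ∫ s in (0 : ℝ)..(dyTime k), ∑ i, A i s • X i (Φ s))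
          Filter.atTop (𝓝 (∫ s in (0 : ℝ)..1, ∑ i, A i s • X i (Φ s))) :=
        (hprim 1 ht).tendsto.comp (tendsto_nhdsWithin_iff.2 ⟨tendsto_dyTime,
          Filter.Eventually.of_forall fun k => ⟨dyTime_nonneg k, (dyTime_lt_one k).le⟩⟩)
      simp only [hgrid] at hlim
      rw [tendsto_nhds_unique hlim (hxy.sub_const (x 0)), hΦ1, add_sub_cancel]
  have hΦ0 : Φ 0 = x 0 := by
    rw [heq 0 (by simp), intervalIntegral.integral_same, add_zero]
  exact ⟨Φ, (continuousOn_const.add hprim).congr heq, A, hΦΩ, hΦ0, hΦ1, hAm, hAb, heq⟩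

lemma Steer.trans (hw : ∀ i, 1 ≤ w i) (hδ : 0 ≤ δ) (hX : ∀ i, ContinuousOn (X i) Ω)
    (hM : ∀ i, ∀ x ∈ Ω, ‖X i x‖ ≤ M) (hxy : Steer X w Ω δ x y) (hyz : Steer X w Ω δ y z) :
    Steer X w Ω (4 * δ) x z := by
  let u : ℕ → V := fun k => if k = 0 then x else if k = 1 then y else z
  refine Steer.of_seq (x := u) hw (by positivity) hX hM hyz.mem_right ?_ fun k => ?_
  · refine tendsto_const_nhds.congr' ?_
    filter_upwards [Filter.eventually_ge_atTop 2] with k hk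
    simp [u, show k ≠ 0 by omega, show k ≠ 1 by omega]
  · match k with
    | 0 => exact hxy.mono hδ (by norm_num; linarith)
    | 1 => exact hyz.mono hδ (by norm_num; linarith)
    | k + 2 => exact Steer.refl (by positivity) hyz.mem_right

end InfiniteConcatenation

section Expansion

lemma exists_arc {V : Type*} [NormedAddCommGroup V] [NormedSpace ℝ V] [CompleteSpace V]
    {f : V → V} {x₀ x : V} {R L K : NNReal} (hb : ∀ x ∈ Metric.closedBall x₀ R, ‖f x‖ ≤ L)
    (hl : LipschitzOnWith K f (Metric.closedBall x₀ R)) {τ : ℝ} (hτ : 0 ≤ τ)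
    (hLτ : L * τ ≤ R / 2) (hx : x ∈ Metric.closedBall x₀ (R / 2)) :
    ∃ α : ℝ → V, α 0 = x ∧ (∀ s ∈ Icc 0 τ, HasDerivWithinAt α (f (α s)) (Icc 0 τ) s) ∧
      ∀ s ∈ Icc 0 τ, α s ∈ Metric.closedBall x₀ R := by
  let t₀ : Icc 0 τ := ⟨0, le_rfl, hτ⟩
  have hf : IsPicardLindelof (fun _ => f) t₀ x₀ R (R / 2) L K := by
    refine IsPicardLindelof.of_time_independent hb hl ?_
    simp only [t₀, sub_zero, sub_self, max_eq_left hτ]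
    push_cast
    linarith
  obtain ⟨α, hα⟩ := ODE.FunSpace.exists_isFixedPt_next hf (x := x) (by simpa using hx)
  refine ⟨α.compProj, ?_, fun t ht => ?_, fun t _ => α.compProj_mem_closedBall hf.mul_max_le⟩
  · have : α.compProj t₀ = x := by rw [ODE.FunSpace.compProj_val, ← hα, ODE.FunSpace.next_apply₀]
    exact this
  · refine (ODE.hasDerivWithinAt_picard_Icc t₀.2 hf.continuousOn_uncurry
      α.continuous_compProj.continuousOn (fun _ _ => α.compProj_mem_closedBall hf.mul_max_le)
      x ht).congr_of_mem (fun t' ht' => ?_) ht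
    nth_rw 1 [← hα]
    rw [ODE.FunSpace.compProj_of_mem ht', ODE.FunSpace.next_apply]

variable {ι : Type*} {V : Type*} [NormedAddCommGroup V] [NormedSpace ℝ V]

lemma norm_shiftOp_pow_apply_le (w : ι → ℕ) (m : ℕ) (i : ι) {c : ℝ} (hc : 0 ≤ c) (j : ℕ)
    {g : List ι → V} (hg : ∀ l, ‖g l‖ ≤ c) (l : List ι) : ‖(shiftOp V w m i ^ j) g l‖ ≤ c := by
  induction j generalizing l with
  | zero => simpa using hg l
  | succ j ih =>
    rw [pow_succ', Module.End.mul_apply, shiftOp_apply]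
    split_ifs
    · exact ih _
    · simpa using hc

lemma shiftExp_apply (w : ι → ℕ) (m : ℕ) (i : ι) (σ : ℝ) (g : List ι → V) (l : List ι) :
    shiftExp V w m i σ g l = ∑ j ∈ Finset.range (m + 1),
      ((j.factorial : ℝ)⁻¹ * σ ^ j) • (shiftOp V w m i ^ j) g l := by
  simp [shiftExp, LinearMap.sum_apply, Finset.sum_apply]

lemma norm_shiftExp_apply_le (w : ι → ℕ) (m : ℕ) (i : ι) {σ c : ℝ} (hσ : |σ| ≤ 1) (hc : 0 ≤ c)
    {g : List ι → V} (hg : ∀ l, ‖g l‖ ≤ c) (l : List ι) :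
    ‖shiftExp V w m i σ g l‖ ≤ (m + 1) * c := by
  rw [shiftExp_apply]
  have : ((m : ℝ) + 1) * c = ∑ _j ∈ Finset.range (m + 1), c := by simp
  rw [this]
  refine norm_sum_le_of_le _ fun j _ => ?_
  rw [norm_smul, norm_mul, norm_pow, Real.norm_eq_abs, Real.norm_eq_abs]
  have h1 : |((j.factorial : ℝ)⁻¹)| ≤ 1 := by
    rw [abs_of_nonneg (by positivity)]
    exact inv_le_one_of_one_le₀ (by exact_mod_cast j.factorial_pos)
  have h2 : |σ| ^ j ≤ 1 := pow_le_one₀ (abs_nonneg _) hσ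
  calc _ ≤ (1 * 1) * c := by
        gcongr
        exact norm_shiftOp_pow_apply_le w m i hc j hg l
    _ = c := by ring

lemma shiftExp_apply_of_lt (w : ι → ℕ) (m : ℕ) (i : ι) (σ : ℝ) (g : List ι → V) {l : List ι}
    (hl : m < wordWt w (i :: l)) : shiftExp V w m i σ g l = g l := by
  rw [shiftExp_apply, Finset.sum_range_succ', Finset.sum_eq_zero]
  · simp
  · intro j _
    rw [pow_succ' (shiftOp V w m i), Module.End.mul_apply, shiftOp_apply, if_neg hl.not_ge,
      smul_zero]

lemma shiftExp_zero (w : ι → ℕ) (m : ℕ) (i : ι) : shiftExp V w m i 0 = 1 := by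
  rw [shiftExp, Finset.sum_range_succ', Finset.sum_eq_zero]
  · simp
  · intro j _
    simp

lemma hasDerivAt_shiftExp {w : ι → ℕ} (hw : ∀ i, 1 ≤ w i) (m : ℕ) (i : ι) (σ u : ℝ)
    (g : List ι → V) (l : List ι) :
    HasDerivAt (fun u => shiftExp V w m i (σ * u) g l)
      (σ • shiftOp V w m i (shiftExp V w m i (σ * u) g) l) u := by
  have h0 : shiftOp V w m i (shiftExp V w m i (σ * u) g) = ∑ j ∈ Finset.range m,
      ((j.factorial : ℝ)⁻¹ * (σ * u) ^ j) • (shiftOp V w m i ^ (j + 1)) g := by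
    rw [← Module.End.mul_apply, shiftExp, Finset.mul_sum, Finset.sum_range_succ]
    simp only [mul_smul_comm, ← pow_succ', shiftOp_pow_eq_zero hw, smul_zero, add_zero,
      LinearMap.sum_apply, LinearMap.smul_apply]
  simp only [shiftExp_apply]
  rw [h0]
  have key : ∀ j ∈ Finset.range (m + 1), HasDerivAt
      (fun u => ((j.factorial : ℝ)⁻¹ * (σ * u) ^ j) • (shiftOp V w m i ^ j) g l)
      (((j.factorial : ℝ)⁻¹ * (j * (σ * u) ^ (j - 1) * (σ * 1))) •
        (shiftOp V w m i ^ j) g l) u := by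
    intro j _
    exact ((((hasDerivAt_id u).const_mul σ).pow j).const_mul _).smul_const _
  have h1 := HasDerivAt.fun_sum key
  convert h1 using 1
  rw [Finset.sum_range_succ', Finset.sum_apply, Finset.smul_sum]
  simp only [Nat.cast_zero, zero_mul, mul_zero, zero_smul, add_zero, Nat.add_sub_cancel]
  refine Finset.sum_congr rfl fun j _ => ?_
  rw [Pi.smul_apply, smul_smul]
  congr 1
  have : (j.factorial : ℝ) ≠ 0 := by positivity
  rw [Nat.factorial_succ]
  push_cast
  field_simp

variable {X : ι → V → V} {w : ι → ℕ} {r : ℕ} {Ω : Set V}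

lemma jet_arc_sub_shiftExp_le (hΩ : IsOpen Ω)
    (hX : ∀ i, w i ≤ r → ContDiffOn ℝ ((r - w i : ℕ)) (X i) Ω) (hw : ∀ i, 1 ≤ w i)
    {m : ℕ} (hm : m ≤ r) {i : ι} {α : ℝ → V} {σ t c : ℝ} (ht : 0 < t) (hσ : |σ| ≤ 1) (hc : 0 ≤ c)
    (hα : ∀ s ∈ Icc 0 (t ^ w i), HasDerivWithinAt α (σ • X i (α s)) (Icc 0 (t ^ w i)) s)
    (hαΩ : ∀ s ∈ Icc 0 (t ^ w i), α s ∈ Ω)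
    (hbase : ∀ l, wordWt w l ≤ m → m < wordWt w (i :: l) → ∀ s ∈ Icc 0 (t ^ w i),
      t ^ wordWt w l * ‖wordField X l (α s) - wordField X l (α 0)‖ ≤ c) (l : List ι) :
    ‖jet X w m t (α (t ^ w i)) l - shiftExp V w m i σ (jet X w m t (α 0)) l‖ ≤ c := by
  set τ := t ^ w i with hτ
  have hτ0 : 0 < τ := by positivity
  have hmaps : ∀ u ∈ Icc (0 : ℝ) 1, τ * u ∈ Icc 0 τ := fun u hu =>
    ⟨mul_nonneg hτ0.le hu.1, mul_le_of_le_one_right hτ0.le hu.2⟩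
  let D : List ι → ℝ → V := fun l u =>
    jet X w m t (α (τ * u)) l - shiftExp V w m i (σ * u) (jet X w m t (α 0)) l
  have hD0 : ∀ l, D l 0 = 0 := fun l => by simp [D, shiftExp_zero]
  have key : ∀ N l, m < wordWt w l + N → ∀ u ∈ Icc (0 : ℝ) 1, ‖D l u‖ ≤ c := by
    intro N
    induction N with
    | zero =>
      intro l hl u _
      have hil : m < wordWt w (i :: l) := by rw [wordWt_cons]; omega
      simpa [D, shiftExp_apply_of_lt w m i _ _ hil, jet_of_lt (show m < wordWt w l by omega)]
        using hc
    | succ N ih =>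
      intro l hl u hu
      rcases lt_or_ge m (wordWt w l) with hlt | hle
      · exact ih l (by omega) u hu
      rcases lt_or_ge m (wordWt w (i :: l)) with hilt | hile
      · simp only [D]
        rw [shiftExp_apply_of_lt w m i _ _ hilt, jet_of_le hle, jet_of_le hle, ← smul_sub,
          norm_smul, Real.norm_of_nonneg (by positivity)]
        exact hbase l hle hilt _ (hmaps u hu)
      have hwi := hw i
      have hile' := hile
      rw [wordWt_cons] at hile'
      have hder : ∀ u ∈ Icc (0 : ℝ) 1,
          HasDerivWithinAt (D l) (σ • D (i :: l) u) (Icc 0 1) u := by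
        intro u hu
        have hd : DifferentiableAt ℝ (wordField X l) (α (τ * u)) :=
          ((contDiffOn_wordField hΩ hX hw l (by omega)).contDiffAt
            (hΩ.mem_nhds (hαΩ _ (hmaps u hu)))).differentiableAt
              (by exact_mod_cast (by omega : r - wordWt w l ≠ 0))
        have h1 : HasDerivWithinAt (fun u => α (τ * u)) ((τ * σ) • X i (α (τ * u)))
            (Icc 0 1) u := by
          have := (hα _ (hmaps u hu)).scomp u
            (((hasDerivAt_id u).const_mul τ).hasDerivWithinAt (s := Icc 0 1)) hmaps
          rw [mul_one, smul_smul] at this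
          exact this
        have h2 := (hd.hasFDerivAt.comp_hasDerivWithinAt u h1).const_smul (t ^ wordWt w l)
        have h3 := (hasDerivAt_shiftExp hw m i σ u (jet X w m t (α 0)) l).hasDerivWithinAt
          (s := Icc 0 1)
        have h4 := h2.sub h3
        have e1 : D l = (t ^ wordWt w l • (wordField X l ∘ fun u => α (τ * u))) -
            fun u => shiftExp V w m i (σ * u) (jet X w m t (α 0)) l := by
          ext u
          simp [D, jet_of_le hle]
        have e2 : σ • D (i :: l) u = t ^ wordWt w l • fderiv ℝ (wordField X l) (α (τ * u))
              ((τ * σ) • X i (α (τ * u))) -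
            σ • shiftOp V w m i (shiftExp V w m i (σ * u) (jet X w m t (α 0))) l := by
          simp only [D]
          rw [shiftOp_apply, if_pos hile, jet_of_le hile, smul_sub, map_smul, wordWt_cons, pow_add,
            smul_smul, smul_smul]
          congr 2
          ring
        rw [e1, e2]
        exact h4
      have hle1 := norm_image_sub_le_of_norm_deriv_le_segment' hder (C := c) (fun v hv => by
        rw [norm_smul, Real.norm_eq_abs]
        have h1 := ih (i :: l) (by rw [wordWt_cons]; omega) v (Ico_subset_Icc_self hv)
        exact (mul_le_of_le_one_left (norm_nonneg _) hσ).trans h1) u hu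
      rw [hD0, sub_zero, sub_zero] at hle1
      exact hle1.trans (mul_le_of_le_one_right hc hu.2)
  have := key (m + 1) l (by omega) 1 (by simp)
  simpa [D] using this

end Expansion

section LocalSteering

lemma eventually_mul_le_nhdsGT (C : ℝ) {ε : ℝ} (hε : 0 < ε) :
    ∀ᶠ t in 𝓝[>] (0 : ℝ), C * t ≤ ε := by
  have : Filter.Tendsto (fun t : ℝ => C * t) (𝓝[>] 0) (𝓝 0) := by
    simpa using ((continuous_const_mul C).tendsto 0).mono_left nhdsWithin_le_nhds
  exact this.eventually_le_const hε

lemma finite_wordWt_le {ι : Type*} [Finite ι] {w : ι → ℕ} (hw : ∀ i, 1 ≤ w i) (m : ℕ) :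
    {l : List ι | wordWt w l ≤ m}.Finite := by
  have hlen : ∀ l : List ι, l.length ≤ wordWt w l := by
    intro l
    induction l with
    | nil => simp
    | cons i l ih =>
      have := hw i
      rw [wordWt_cons, List.length_cons]
      omega
  exact (List.finite_length_le ι m).subset fun l hl => (hlen l).trans hl

variable {ι : Type*} {V : Type*} [NormedAddCommGroup V] [NormedSpace ℝ V] [ProperSpace V]
  {X : ι → V → V} {w : ι → ℕ} {r m : ℕ} {Ω : Set V} {x₀ : V} {R : NNReal}

lemma eventually_wordField_sub_le (hΩ : IsOpen Ω)
    (hX : ∀ i, w i ≤ r → ContDiffOn ℝ ((r - w i : ℕ)) (X i) Ω) (hw : ∀ i, 1 ≤ w i)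
    (hm : m ≤ r) (hR : Metric.closedBall x₀ R ⊆ Ω) {i : ι} {l : List ι} (hl : wordWt w l ≤ m)
    (hil : m < wordWt w (i :: l)) {L : ℝ} (hL : 0 ≤ L) {ε : ℝ} (hε : 0 < ε) :
    ∀ᶠ t in 𝓝[>] (0 : ℝ), ∀ x ∈ Metric.closedBall x₀ R, ∀ y ∈ Metric.closedBall x₀ R,
      ‖y - x‖ ≤ L * t ^ w i →
        t ^ wordWt w l * ‖wordField X l y - wordField X l x‖ ≤ ε * t ^ m := by
  rw [wordWt_cons] at hil
  have hwi := hw i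
  have hf := (contDiffOn_wordField hΩ hX hw l (hl.trans hm)).mono hR
  rcases hl.eq_or_lt with heq | hlt
  · have huc := (isCompact_closedBall x₀ (R : ℝ)).uniformContinuousOn_of_continuous
      hf.continuousOn
    obtain ⟨δ, hδ, H⟩ := Metric.uniformContinuousOn_iff.1 huc ε hε
    filter_upwards [eventually_mul_le_nhdsGT L (half_pos hδ), eventually_mul_le_nhdsGT 1 one_pos,
      self_mem_nhdsWithin] with t h1 h2 ht x hx y hy hxy
    rw [one_mul] at h2
    have ht : 0 < t := ht
    have hd : dist y x < δ := by
      rw [dist_eq_norm]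
      calc _ ≤ L * t ^ w i := hxy
        _ ≤ L * t := by
          gcongr
          exact pow_le_of_le_one ht.le h2 (by omega)
        _ < δ := by linarith
    have := H y hy x hx hd
    rw [dist_eq_norm] at this
    rw [heq, mul_comm]
    gcongr
  · obtain ⟨K, hK⟩ := hf.exists_lipschitzOnWith
      (by exact_mod_cast (by omega : r - wordWt w l ≠ 0)) (convex_closedBall x₀ (R : ℝ))
      (isCompact_closedBall _ _)
    filter_upwards [eventually_mul_le_nhdsGT (K * L) hε, eventually_mul_le_nhdsGT 1 one_pos,
      self_mem_nhdsWithin] with t h1 h2 ht x hx y hy hxy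
    rw [one_mul] at h2
    have ht : 0 < t := ht
    have hlip := hK.norm_sub_le hy hx
    calc t ^ wordWt w l * ‖wordField X l y - wordField X l x‖
        ≤ t ^ wordWt w l * (K * (L * t ^ w i)) := by
          gcongr
          exact hlip.trans (by gcongr)
      _ = K * L * t ^ (wordWt w l + w i) := by rw [pow_add]; ring
      _ ≤ K * L * t ^ (m + 1) := by
          gcongr ?_ * ?_
          exact pow_le_pow_of_le_one ht.le h2 (by omega)
      _ = K * L * t * t ^ m := by ring
      _ ≤ ε * t ^ m := by gcongr

variable [Fintype ι]

lemma eventually_steer_letter (hΩ : IsOpen Ω)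
    (hX : ∀ i, w i ≤ r → ContDiffOn ℝ ((r - w i : ℕ)) (X i) Ω) (hw : ∀ i, 1 ≤ w i)
    (hX1 : ∀ i, ContDiffOn ℝ 1 (X i) Ω) (hm : m ≤ r) (hR0 : 0 < R)
    (hR : Metric.closedBall x₀ R ⊆ Ω) (i : ι) {σ : ℝ} (hσ : |σ| ≤ 1) {ε : ℝ} (hε : 0 < ε) :
    ∀ᶠ t in 𝓝[>] (0 : ℝ), ∀ x ∈ Metric.closedBall x₀ (R / 2), ∃ y, ‖y - x‖ ≤ ε ∧
      Steer X w Ω t x y ∧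
      ∀ l, ‖jet X w m t y l - shiftExp V w m i σ (jet X w m t x) l‖ ≤ ε * t ^ m := by
  classical
  have hf : ContDiffOn ℝ 1 (fun x => σ • X i x) (Metric.closedBall x₀ R) :=
    ((hX1 i).mono hR).const_smul σ
  obtain ⟨K, hK⟩ := hf.exists_lipschitzOnWith one_ne_zero (convex_closedBall _ _)
    (isCompact_closedBall _ _)
  obtain ⟨L', hL'⟩ := (isCompact_closedBall x₀ (R : ℝ)).exists_bound_of_continuousOn
    hf.continuousOn
  set L : NNReal := Real.toNNReal L' with hLdef
  have hL : ∀ x ∈ Metric.closedBall x₀ (R : ℝ), ‖σ • X i x‖ ≤ L := fun x hx =>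
    (hL' x hx).trans (Real.le_coe_toNNReal _)
  have hwords : ∀ᶠ t in 𝓝[>] (0 : ℝ), ∀ l ∈ {l : List ι | wordWt w l ≤ m},
      m < wordWt w (i :: l) → ∀ x ∈ Metric.closedBall x₀ (R : ℝ),
      ∀ y ∈ Metric.closedBall x₀ (R : ℝ), ‖y - x‖ ≤ L * t ^ w i →
        t ^ wordWt w l * ‖wordField X l y - wordField X l x‖ ≤ ε * t ^ m := by
    rw [Filter.eventually_all_finite (finite_wordWt_le hw m)]
    intro l hl
    rw [Filter.eventually_imp_distrib_left]
    exact fun hil => eventually_wordField_sub_le hΩ hX hw hm hR hl hil L.2 hε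
  filter_upwards [hwords, eventually_mul_le_nhdsGT L hε,
    eventually_mul_le_nhdsGT L (show (0 : ℝ) < R / 2 by positivity),
    eventually_mul_le_nhdsGT 1 one_pos, self_mem_nhdsWithin] with t h1 h2 h3 h4 ht x hx
  rw [one_mul] at h4
  have ht : 0 < t := ht
  have hpow : t ^ w i ≤ t := pow_le_of_le_one ht.le h4 (by have := hw i; omega)
  have hLt : L * t ^ w i ≤ L * t := by gcongr
  have hτ : (0 : ℝ) ≤ t ^ w i := by positivity
  obtain ⟨α, hα0, hα, hαB⟩ := exists_arc hL hK hτ (hLt.trans h3) hx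
  have hαx : ∀ s ∈ Icc 0 (t ^ w i), ‖α s - α 0‖ ≤ L * t ^ w i := by
    intro s hs
    have := norm_image_sub_le_of_norm_deriv_le_segment' hα (C := L)
      (fun s hs => hL _ (hαB s (Ico_subset_Icc_self hs))) s hs
    refine this.trans ?_
    rw [sub_zero]
    exact mul_le_mul_of_nonneg_left hs.2 L.2
  have hαΩ : ∀ s ∈ Icc 0 (t ^ w i), α s ∈ Ω := fun s hs => hR (hαB s hs)
  refine ⟨α (t ^ w i), ?_, ?_, ?_⟩
  · rw [← hα0]
    exact (hαx _ ⟨hτ, le_rfl⟩).trans (hLt.trans h2)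
  · rw [← hα0]
    exact Steer.of_arc (fun i => (hX1 i).continuousOn) ht hσ hα hαΩ
  · intro l
    rw [← hα0]
    refine jet_arc_sub_shiftExp_le hΩ hX hw hm ht hσ (by positivity) hα hαΩ ?_ l
    exact fun l hl hil s hs =>
      h1 l hl hil _ (hαB 0 ⟨le_rfl, hτ⟩) _ (hαB s hs) (hαx s hs)

lemma eventually_steer_word (hΩ : IsOpen Ω)
    (hX : ∀ i, w i ≤ r → ContDiffOn ℝ ((r - w i : ℕ)) (X i) Ω) (hw : ∀ i, 1 ≤ w i)
    (hX1 : ∀ i, ContDiffOn ℝ 1 (X i) Ω) {M : ℝ} (hM : ∀ i, ∀ x ∈ Ω, ‖X i x‖ ≤ M)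
    (hm : m ≤ r) (hR0 : 0 < R)
    (hR : Metric.closedBall x₀ R ⊆ Ω) (L : List (ι × Bool)) :
    ∃ C : ℝ, 1 ≤ C ∧ ∀ ε > 0, ∀ᶠ t in 𝓝[>] (0 : ℝ), ∀ x ∈ Metric.closedBall x₀ (R / 4),
      ∃ y, ‖y - x‖ ≤ ε ∧ Steer X w Ω (C * t) x y ∧
      ∀ l, ‖jet X w m t y l -
        (FreeGroup.lift (shiftUnit V hw m) (FreeGroup.mk L)).val (jet X w m t x) l‖
          ≤ ε * t ^ m := by
  induction L with
  | nil =>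
    refine ⟨1, le_rfl, fun ε hε => ?_⟩
    filter_upwards [self_mem_nhdsWithin] with t ht x hx
    have ht : 0 < t := ht
    refine ⟨x, by simpa using hε.le, Steer.refl (by positivity) (hR ?_), fun l => ?_⟩
    · exact Metric.closedBall_subset_closedBall
        (by have : (0 : ℝ) ≤ R := R.2
            linarith) hx
    · simp only [FreeGroup.lift_mk, List.map_nil, List.prod_nil, Units.val_one,
        Module.End.one_apply, sub_self, norm_zero]
      positivity
  | cons a L ih =>
    obtain ⟨C, hC, ih⟩ := ih
    refine ⟨4 * C, by linarith, fun ε hε => ?_⟩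
    obtain ⟨i, b⟩ := a
    obtain ⟨σ, hσ, hb⟩ : ∃ σ : ℝ, |σ| ≤ 1 ∧
        (FreeGroup.lift (shiftUnit V hw m) (FreeGroup.mk ((i, b) :: L))).val =
        shiftExp V w m i σ *
          (FreeGroup.lift (shiftUnit V hw m) (FreeGroup.mk L)).val := by
      cases b
      · exact ⟨-1, by simp, by
          simp only [FreeGroup.lift_mk, List.map_cons, List.prod_cons, Units.val_mul]; rfl⟩
      · exact ⟨1, by simp, by
          simp only [FreeGroup.lift_mk, List.map_cons, List.prod_cons, Units.val_mul]; rfl⟩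
    have hm1 : (0 : ℝ) < m + 1 := by positivity
    set ε₁ : ℝ := min (R / 4) (ε / 2 / (m + 1)) with hε₁
    have hε₁0 : 0 < ε₁ := by positivity
    have hε₁R : ε₁ ≤ R / 4 := min_le_left _ _
    have hε₁ε : (m + 1) * ε₁ ≤ ε / 2 := by
      rw [mul_comm, ← le_div_iff₀ hm1]
      exact min_le_right _ _
    have hε₁ε' : ε₁ ≤ ε / 2 :=
      (le_mul_of_one_le_left hε₁0.le (by linarith [m.cast_nonneg (α := ℝ)])).trans hε₁ε
    filter_upwards [ih ε₁ hε₁0,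
      eventually_steer_letter hΩ hX hw hX1 hm hR0 hR i hσ (half_pos hε),
      self_mem_nhdsWithin] with t h1 h2 ht x hx
    have ht : 0 < t := ht
    obtain ⟨y, hy1, hy2, hy3⟩ := h1 x hx
    have hyB : y ∈ Metric.closedBall x₀ (R / 2) := by
      rw [mem_closedBall_iff_norm] at hx ⊢
      calc ‖y - x₀‖ = ‖(y - x) + (x - x₀)‖ := by rw [sub_add_sub_cancel]
        _ ≤ ‖y - x‖ + ‖x - x₀‖ := norm_add_le _ _
        _ ≤ R / 2 := by linarith
    obtain ⟨z, hz1, hz2, hz3⟩ := h2 y hyB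
    refine ⟨z, ?_, ?_, fun l => ?_⟩
    · calc ‖z - x‖ = ‖(z - y) + (y - x)‖ := by rw [sub_add_sub_cancel]
        _ ≤ ‖z - y‖ + ‖y - x‖ := norm_add_le _ _
        _ ≤ ε := by linarith
    · rw [mul_assoc]
      refine Steer.trans hw (by positivity) (fun i => (hX1 i).continuousOn) hM hy2
        (hz2.mono ht.le ?_)
      nlinarith
    · rw [hb, Module.End.mul_apply]
      set P := (FreeGroup.lift (shiftUnit V hw m) (FreeGroup.mk L)).val with hP
      have hS := norm_shiftExp_apply_le w m i hσ (show 0 ≤ ε₁ * t ^ m by positivity)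
        (g := jet X w m t y - P (jet X w m t x)) hy3 l
      rw [map_sub, Pi.sub_apply] at hS
      calc _ ≤ ‖jet X w m t z l - shiftExp V w m i σ (jet X w m t y) l‖ +
            ‖shiftExp V w m i σ (jet X w m t y) l -
              shiftExp V w m i σ (P (jet X w m t x)) l‖ := norm_sub_le_norm_sub_add_norm_sub _ _ _
        _ ≤ ε / 2 * t ^ m + (m + 1) * ε₁ * t ^ m := by
            rw [mul_assoc (_ + _)]
            exact add_le_add (hz3 l) hS
        _ ≤ ε / 2 * t ^ m + ε / 2 * t ^ m := by gcongr
        _ = ε * t ^ m := by ring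

/-- Approximate motion along an iterated commutator, in either direction. -/
lemma eventually_steer_iterComm (hΩ : IsOpen Ω)
    (hX : ∀ i, w i ≤ r → ContDiffOn ℝ ((r - w i : ℕ)) (X i) Ω) (hw : ∀ i, 1 ≤ w i)
    (hX1 : ∀ i, ContDiffOn ℝ 1 (X i) Ω) {M : ℝ} (hM : ∀ i, ∀ x ∈ Ω, ‖X i x‖ ≤ M)
    (hR0 : 0 < R) (hR : Metric.closedBall x₀ R ⊆ Ω) {k : ℕ} (f : Fin (k + 1) → ι)
    (hf : ∑ j, w (f j) ≤ r) {s : ℝ} (hs : s = 1 ∨ s = -1) :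
    ∃ C : ℝ, 1 ≤ C ∧ ∀ ε > 0, ∀ᶠ t in 𝓝[>] (0 : ℝ), ∀ x ∈ Metric.closedBall x₀ (R / 4),
      ∃ y, Steer X w Ω (C * t) x y ∧
        ‖y - x - (s * t ^ ∑ j, w (f j)) • iterComm X k f x‖ ≤ ε * t ^ ∑ j, w (f j) := by
  classical
  set m := ∑ j, w (f j) with hm
  obtain ⟨g, hg⟩ : ∃ g : FreeGroup ι, Raises w (m + 1)
      ((FreeGroup.lift (shiftUnit V hw m) g).val - 1 - s • brOp V w m k f) := by
    obtain ⟨-, h2, h3⟩ := raises_lift_brWord (V := V) hw m k f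
    rcases hs with rfl | rfl
    · exact ⟨brWord k f, by simpa using h3⟩
    · refine ⟨(brWord k f)⁻¹, ?_⟩
      have := Raises.inv_sub_one_add (one_le_sum_weights hw f) (raises_brOp w m k f) h3 h2
      rw [map_inv, show (-1 : ℝ) • brOp V w m k f = -brOp V w m k f by ext; simp, sub_neg_eq_add]
      exact this
  obtain ⟨C, hC, H⟩ := eventually_steer_word hΩ hX hw hX1 hM hf hR0 hR g.toWord
  refine ⟨C, hC, fun ε hε => ?_⟩
  filter_upwards [H ε hε] with t h1 x hx
  obtain ⟨y, -, hy2, hy3⟩ := h1 x hx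
  refine ⟨y, hy2, ?_⟩
  have hxΩ : x ∈ Ω := hR (Metric.closedBall_subset_closedBall
    (by have : (0 : ℝ) ≤ R := R.2
        linarith) hx)
  have h0 := hy3 []
  have e1 := hg 0 (jet X w m t x) (fun l hl => jet_of_lt (by omega) t x) [] (Nat.zero_le _)
  have e2 := brOp_jet hΩ hX hw hf t k f [] (by simp [hm]) hxΩ
  rw [FreeGroup.mk_toWord] at h0
  rw [LinearMap.sub_apply, LinearMap.sub_apply, Pi.sub_apply, Pi.sub_apply, LinearMap.smul_apply,
    Pi.smul_apply, Module.End.one_apply, e2, sub_sub, sub_eq_zero] at e1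
  rw [e1, jet_of_le (by simp), jet_of_le (by simp)] at h0
  simpa [wordField, smul_smul, sub_sub] using h0

end LocalSteering

section LocalBound

lemma exists_closedBall_subset {V : Type*} [SeminormedAddCommGroup V] {Ω : Set V} {x₀ : V}
    (hΩ : IsOpen Ω) (hx₀ : x₀ ∈ Ω) :
    ∃ R : NNReal, 0 < R ∧ Metric.closedBall x₀ R ⊆ Ω := by
  obtain ⟨R, hR, h⟩ := Metric.nhds_basis_closedBall.mem_iff.1 (hΩ.mem_nhds hx₀)
  exact ⟨⟨R, hR.le⟩, hR, h⟩

variable {ι : Type*} [Fintype ι] {V : Type*} [NormedAddCommGroup V] [NormedSpace ℝ V]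
  {X : ι → V → V} {w : ι → ℕ} {r : ℕ} {Ω : Set V} {x₀ : V}

lemma eventually_steer_commOf [ProperSpace V] (hΩ : IsOpen Ω)
    (hX : ∀ i, w i ≤ r → ContDiffOn ℝ ((r - w i : ℕ)) (X i) Ω) (hw : ∀ i, 1 ≤ w i)
    (hX1 : ∀ i, ContDiffOn ℝ 1 (X i) Ω) {M : ℝ} (hM : ∀ i, ∀ x ∈ Ω, ‖X i x‖ ≤ M)
    (hx₀ : x₀ ∈ Ω) (I : MIdx ι r) (hI : wtOf w I ≤ r) :
    ∃ C : ℝ, 1 ≤ C ∧ ∃ ρ > 0, ∀ ε > 0, ∀ᶠ h in 𝓝 (0 : ℝ), ∀ x ∈ Metric.closedBall x₀ ρ,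
      ∃ y, Steer X w Ω (C * |h| ^ (r : ℝ)⁻¹) x y ∧ ‖y - x - h • commOf X I x‖ ≤ ε * |h| := by
  obtain ⟨R, hR0, hR⟩ := exists_closedBall_subset hΩ hx₀
  obtain ⟨C₁, hC₁, H₁⟩ := eventually_steer_iterComm hΩ hX hw hX1 hM hR0 hR I.2 hI (Or.inl rfl)
  obtain ⟨C₂, hC₂, H₂⟩ := eventually_steer_iterComm hΩ hX hw hX1 hM hR0 hR I.2 hI (Or.inr rfl)
  refine ⟨max C₁ C₂, le_max_of_le_left hC₁, R / 4, by positivity, fun ε hε => ?_⟩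
  have hm1 : 1 ≤ wtOf w I := one_le_sum_weights hw I.2
  change ∑ j, w (I.2 j) ≤ r at hI
  change 1 ≤ ∑ j, w (I.2 j) at hm1
  set m := ∑ j, w (I.2 j) with hm
  have hm0 : (0 : ℝ) < m := by exact_mod_cast hm1
  have htend : Filter.Tendsto (fun h : ℝ => |h| ^ (m : ℝ)⁻¹) (𝓝[≠] 0) (𝓝[>] 0) := by
    refine tendsto_nhdsWithin_iff.2 ⟨?_, ?_⟩
    · have hc : Continuous fun h : ℝ => |h| ^ (m : ℝ)⁻¹ :=
        continuous_abs.rpow_const fun _ => Or.inr (by positivity)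
      have := (hc.tendsto 0).mono_left (nhdsWithin_le_nhds (s := {0}ᶜ))
      rwa [abs_zero, Real.zero_rpow (by positivity)] at this
    · filter_upwards [self_mem_nhdsWithin] with h hh
      exact Real.rpow_pos_of_pos (abs_pos.2 hh) _
  have hev := htend.eventually ((H₁ ε hε).and (H₂ ε hε))
  rw [eventually_nhdsWithin_iff] at hev
  filter_upwards [hev, (continuous_abs.tendsto (0 : ℝ)).eventually_le_const
    (by simp : |(0 : ℝ)| < 1)] with h hev h1 x hx
  by_cases h0 : h = 0
  · subst h0
    refine ⟨x, Steer.refl (by positivity) (hR ?_), by simp⟩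
    exact Metric.closedBall_subset_closedBall (by linarith [R.2, NNReal.coe_nonneg R]) hx
  obtain ⟨hp, hn⟩ := hev h0
  have hpow : (|h| ^ (m : ℝ)⁻¹) ^ m = |h| := by
    rw [← Real.rpow_natCast, ← Real.rpow_mul (abs_nonneg h), inv_mul_cancel₀ hm0.ne',
      Real.rpow_one]
  have hle : |h| ^ (m : ℝ)⁻¹ ≤ |h| ^ (r : ℝ)⁻¹ :=
    Real.rpow_le_rpow_of_exponent_ge (abs_pos.2 h0) h1
      (inv_anti₀ hm0 (by exact_mod_cast hI))
  rw [hpow] at hp hn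
  rcases lt_or_gt_of_ne h0 with hneg | hpos
  · obtain ⟨y, hy1, hy2⟩ := hn x hx
    refine ⟨y, hy1.mono (by positivity) ?_, ?_⟩
    · gcongr
      exact le_max_right _ _
    · rwa [abs_of_neg hneg, neg_one_mul, neg_neg, ← abs_of_neg hneg] at hy2
  · obtain ⟨y, hy1, hy2⟩ := hp x hx
    refine ⟨y, hy1.mono (by positivity) ?_, ?_⟩
    · gcongr
      exact le_max_left _ _
    · rw [one_mul] at hy2
      nth_rw 1 [abs_of_pos hpos] at hy2
      exact hy2

lemma exists_steer_sum [ProperSpace V] (hΩ : IsOpen Ω)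
    (hX : ∀ i, w i ≤ r → ContDiffOn ℝ ((r - w i : ℕ)) (X i) Ω) (hw : ∀ i, 1 ≤ w i)
    (hX1 : ∀ i, ContDiffOn ℝ 1 (X i) Ω) {M : ℝ} (hM : ∀ i, ∀ x ∈ Ω, ‖X i x‖ ≤ M)
    (hx₀ : x₀ ∈ Ω) (s : Finset (MIdx ι r)) (hs : ∀ I ∈ s, wtOf w I ≤ r) :
    ∃ C : ℝ, 1 ≤ C ∧ ∀ ε > 0, ∃ ρ > 0, ∃ η > 0, ∀ x ∈ Metric.closedBall x₀ ρ,
      ∀ τ ∈ Icc 0 η, ∀ h : MIdx ι r → ℝ, (∀ I, |h I| ≤ τ) →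
      ∃ y, Steer X w Ω (C * τ ^ (r : ℝ)⁻¹) x y ∧
        ‖y - x - ∑ I ∈ s, h I • commOf X I x₀‖ ≤ ε * τ := by
  classical
  induction s using Finset.induction_on with
  | empty =>
    refine ⟨1, le_rfl, fun ε hε => ?_⟩
    obtain ⟨R, hR0, hR⟩ := exists_closedBall_subset hΩ hx₀
    refine ⟨R, hR0, 1, one_pos, fun x hx τ hτ h _ => ⟨x, Steer.refl ?_ (hR hx), ?_⟩⟩
    · have := hτ.1
      positivity
    · simpa using mul_nonneg hε.le hτ.1
  | insert I s hIs ih =>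
    obtain ⟨C₁, hC₁, ih⟩ := ih fun J hJ => hs J (Finset.mem_insert_of_mem hJ)
    have hI := hs I (Finset.mem_insert_self I s)
    obtain ⟨C₂, hC₂, ρ₂, hρ₂, H⟩ := eventually_steer_commOf hΩ hX hw hX1 hM hx₀ I hI
    refine ⟨4 * max C₁ C₂, by linarith [le_max_left C₁ C₂], fun ε hε => ?_⟩
    have hcont : ContinuousAt (commOf X I) x₀ :=
      (contDiffOn_iterComm hΩ hX hw _ I.2 hI).continuousOn.continuousAt (hΩ.mem_nhds hx₀)
    obtain ⟨ρ₃, hρ₃, hcont⟩ := Metric.nhds_basis_closedBall.eventually_iff.1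
      (Metric.continuousAt_iff'.1 hcont (ε / 4) (by positivity))
    obtain ⟨η₂, hη₂, H⟩ := Metric.nhds_basis_closedBall.eventually_iff.1
      (H (ε / 4) (by positivity))
    obtain ⟨ρ₁, hρ₁, η₁, hη₁, ih⟩ := ih (ε / 2) (by positivity)
    set B := ε / 2 + ∑ J ∈ s, ‖commOf X J x₀‖ with hB
    have hB0 : 0 < B := by positivity
    set ρ' := min ρ₂ ρ₃ with hρ'
    have hρ'0 : 0 < ρ' := lt_min hρ₂ hρ₃
    refine ⟨min ρ₁ (ρ' / 2), by positivity, min (min η₁ η₂) (ρ' / 2 / B), by positivity,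
      fun x hx τ hτ h hh => ?_⟩
    have hτ0 : 0 ≤ τ := hτ.1
    have hτ1 : τ ≤ η₁ := hτ.2.trans ((min_le_left _ _).trans (min_le_left _ _))
    have hτ2 : τ ≤ η₂ := hτ.2.trans ((min_le_left _ _).trans (min_le_right _ _))
    have hτ3 : τ * B ≤ ρ' / 2 := (le_div_iff₀ hB0).1 (hτ.2.trans (min_le_right _ _))
    have hx1 := Metric.closedBall_subset_closedBall (min_le_left _ _) hx
    have hx2 := Metric.closedBall_subset_closedBall (min_le_right _ _) hx
    obtain ⟨y, hy1, hy2⟩ := ih x hx1 τ ⟨hτ0, hτ1⟩ h hh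
    have hsum : ‖∑ J ∈ s, h J • commOf X J x₀‖ ≤ τ * ∑ J ∈ s, ‖commOf X J x₀‖ := by
      rw [Finset.mul_sum]
      refine norm_sum_le_of_le _ fun J _ => ?_
      rw [norm_smul, Real.norm_eq_abs]
      exact mul_le_mul_of_nonneg_right (hh J) (norm_nonneg _)
    have hyB : ‖y - x₀‖ ≤ ρ' := by
      rw [mem_closedBall_iff_norm] at hx2
      have e : y - x₀ = (y - x - ∑ J ∈ s, h J • commOf X J x₀) +
          ∑ J ∈ s, h J • commOf X J x₀ + (x - x₀) := by abel
      rw [e]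
      refine (norm_add₃_le).trans ?_
      have : τ * B = ε / 2 * τ + τ * ∑ J ∈ s, ‖commOf X J x₀‖ := by rw [hB]; ring
      linarith
    obtain ⟨z, hz1, hz2⟩ := H (x := h I) (by simpa using (hh I).trans hτ2) y
      (mem_closedBall_iff_norm.2 (hyB.trans (min_le_left _ _)))
    have hcy := (hcont (mem_closedBall_iff_norm.2 (hyB.trans (min_le_right _ _)))).le
    rw [dist_eq_norm] at hcy
    have hCτ : 0 ≤ max C₁ C₂ * τ ^ (r : ℝ)⁻¹ := by positivity
    refine ⟨z, ?_, ?_⟩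
    · rw [mul_assoc]
      refine Steer.trans hw hCτ (fun i => (hX1 i).continuousOn) hM (hy1.mono (by positivity) ?_)
        (hz1.mono (by positivity) ?_)
      · gcongr
        exact le_max_left _ _
      · gcongr
        · exact le_max_right _ _
        · exact hh I
    · rw [Finset.sum_insert hIs]
      have e : z - x - (h I • commOf X I x₀ + ∑ J ∈ s, h J • commOf X J x₀) =
          (z - y - h I • commOf X I y) + (y - x - ∑ J ∈ s, h J • commOf X J x₀) +
          h I • (commOf X I y - commOf X I x₀) := by rw [smul_sub]; abel
      rw [e]
      refine (norm_add₃_le).trans ?_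
      have h3 : ‖h I • (commOf X I y - commOf X I x₀)‖ ≤ τ * (ε / 4) := by
        rw [norm_smul, Real.norm_eq_abs]
        exact mul_le_mul (hh I) hcy (norm_nonneg _) hτ0
      have h4 : ε / 4 * |h I| ≤ ε / 4 * τ := by gcongr; exact hh I
      linarith

end LocalBound

section GlobalBound

variable {ι : Type*} [Fintype ι] {V : Type*} [NormedAddCommGroup V] [NormedSpace ℝ V]
  {X : ι → V → V} {w : ι → ℕ} {r : ℕ} {Ω : Set V}

lemma HormSpan.exists_coeff [FiniteDimensional ℝ V] (hH : HormSpan X w r Ω) {x₀ : V}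
    (hx₀ : x₀ ∈ Ω) :
    ∃ B : ℝ, 0 < B ∧ ∀ v : V, ∃ h : MIdx ι r → ℝ, (∀ I, |h I| ≤ B * ‖v‖) ∧
      ∑ I with wtOf w I ≤ r, h I • commOf X I x₀ = v := by
  classical
  let Φ : (MIdx ι r → ℝ) →ₗ[ℝ] V :=
    ∑ I with wtOf w I ≤ r, (LinearMap.proj I).smulRight (commOf X I x₀)
  have hΦ : ∀ h, Φ h = ∑ I with wtOf w I ≤ r, h I • commOf X I x₀ := fun h => by
    simp [Φ, LinearMap.sum_apply]
  have hsurj : LinearMap.range Φ = ⊤ := by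
    rw [eq_top_iff, ← hH x₀ hx₀, Submodule.span_le]
    rintro _ ⟨I, hI, rfl⟩
    refine ⟨Pi.single I 1, ?_⟩
    rw [hΦ, Finset.sum_eq_single I]
    · simp
    · intro J _ hJ
      simp [hJ]
    · simp [hI]
  obtain ⟨Ψ, hΨ⟩ := Φ.exists_rightInverse_of_surjective hsurj
  refine ⟨‖Ψ.toContinuousLinearMap‖ + 1, by positivity, fun v => ⟨Ψ v, fun I => ?_, ?_⟩⟩
  · calc |Ψ v I| ≤ ‖Ψ v‖ := norm_le_pi_norm (Ψ v) I
      _ ≤ ‖Ψ.toContinuousLinearMap‖ * ‖v‖ := Ψ.toContinuousLinearMap.le_opNorm v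
      _ ≤ _ := by gcongr; linarith
  · rw [← hΦ]
    exact LinearMap.congr_fun hΨ v

lemma exists_steer_approx [FiniteDimensional ℝ V] (hΩ : IsOpen Ω)
    (hX : ∀ i, w i ≤ r → ContDiffOn ℝ ((r - w i : ℕ)) (X i) Ω) (hw : ∀ i, 1 ≤ w i)
    (hX1 : ∀ i, ContDiffOn ℝ 1 (X i) Ω) {M : ℝ} (hM : ∀ i, ∀ x ∈ Ω, ‖X i x‖ ≤ M)
    (hH : HormSpan X w r Ω) {x₀ : V} (hx₀ : x₀ ∈ Ω) {κ : ℝ} (hκ : 0 < κ) :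
    ∃ C : ℝ, 0 < C ∧ ∃ ρ > 0, ∃ η > 0, ∀ x ∈ Metric.closedBall x₀ ρ, ∀ v : V, ‖v‖ ≤ η →
      ∃ z, Steer X w Ω (C * ‖v‖ ^ (r : ℝ)⁻¹) x z ∧ ‖z - (x + v)‖ ≤ κ * ‖v‖ := by
  have := FiniteDimensional.proper ℝ V
  obtain ⟨B, hB, hcoeff⟩ := hH.exists_coeff hx₀
  obtain ⟨C, hC, H⟩ := exists_steer_sum hΩ hX hw hX1 hM hx₀
    (Finset.univ.filter fun I : MIdx ι r => wtOf w I ≤ r) (by simp)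
  obtain ⟨ρ, hρ, η, hη, H⟩ := H (κ / B) (by positivity)
  refine ⟨C * B ^ (r : ℝ)⁻¹, by positivity, ρ, hρ, η / B, by positivity, fun x hx v hv => ?_⟩
  obtain ⟨h, hh, hsum⟩ := hcoeff v
  obtain ⟨z, hz1, hz2⟩ := H x hx (B * ‖v‖)
    ⟨by positivity, by rwa [mul_comm, ← le_div_iff₀ hB]⟩ h hh
  refine ⟨z, ?_, ?_⟩
  · rwa [mul_assoc, ← Real.mul_rpow hB.le (norm_nonneg v)]
  · rw [hsum, sub_sub] at hz2
    refine hz2.trans_eq ?_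
    field_simp

/-- The Hölder bound for steering near a point, by Newton-type iteration of the approximate
steering. -/
lemma exists_steer_ball [FiniteDimensional ℝ V] (hΩ : IsOpen Ω) (hr : r ≠ 0)
    (hX : ∀ i, w i ≤ r → ContDiffOn ℝ ((r - w i : ℕ)) (X i) Ω) (hw : ∀ i, 1 ≤ w i)
    (hX1 : ∀ i, ContDiffOn ℝ 1 (X i) Ω) {M : ℝ} (hM : ∀ i, ∀ x ∈ Ω, ‖X i x‖ ≤ M)
    (hH : HormSpan X w r Ω) {x₀ : V} (hx₀ : x₀ ∈ Ω) :
    ∃ C : ℝ, 0 < C ∧ ∃ ρ > 0, ∀ x ∈ Metric.ball x₀ ρ, ∀ y ∈ Metric.ball x₀ ρ,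
      Steer X w Ω (C * ‖x - y‖ ^ (r : ℝ)⁻¹) x y := by
  obtain ⟨R, hR0, hR⟩ := exists_closedBall_subset hΩ hx₀
  obtain ⟨C, hC, ρ, hρ, η, hη, H⟩ := exists_steer_approx hΩ hX hw hX1 hM hH hx₀
    (κ := (1 / 2) ^ r) (by positivity)
  refine ⟨2 * C, by positivity, min R (min (ρ / 3) (η / 2)), by positivity, fun x hx y hy => ?_⟩
  rw [mem_ball_iff_norm, lt_min_iff, lt_min_iff] at hx hy
  have hxy : ‖x - y‖ ≤ ‖x - x₀‖ + ‖y - x₀‖ := by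
    simpa using norm_sub_le (x - x₀) (y - x₀)
  choose! z hz1 hz2 using H
  let u : ℕ → V := fun k => Nat.rec x (fun _ q => z q (y - q)) k
  have hu : ∀ k, u (k + 1) = z (u k) (y - u k) := fun _ => rfl
  have hsmall : ∀ q, ‖y - q‖ ≤ ‖x - y‖ → q ∈ Metric.closedBall x₀ ρ ∧ ‖y - q‖ ≤ η := by
    intro q hq
    have : ‖q - x₀‖ ≤ ‖y - q‖ + ‖y - x₀‖ := by
      rw [show q - x₀ = (y - x₀) - (y - q) by abel, add_comm]
      exact norm_sub_le _ _
    exact ⟨mem_closedBall_iff_norm.2 (by linarith), by linarith⟩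
  have hdist : ∀ k, ‖y - u k‖ ≤ ((1 / 2) ^ k) ^ r * ‖x - y‖ := by
    intro k
    induction k with
    | zero => simp [u, norm_sub_rev]
    | succ k ih =>
      have hle : ‖y - u k‖ ≤ ‖x - y‖ :=
        ih.trans (mul_le_of_le_one_left (norm_nonneg _)
          (pow_le_one₀ (by positivity) (pow_le_one₀ (by norm_num) (by norm_num))))
      have := hz2 (u k) (hsmall _ hle).1 (y - u k) (hsmall _ hle).2
      rw [add_sub_cancel, ← hu, norm_sub_rev] at this
      calc ‖y - u (k + 1)‖ ≤ (1 / 2) ^ r * ‖y - u k‖ := this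
        _ ≤ (1 / 2) ^ r * (((1 / 2) ^ k) ^ r * ‖x - y‖) := by gcongr
        _ = _ := by rw [pow_succ (1 / 2 : ℝ) k, mul_pow]; ring
  refine Steer.of_seq (x := u) hw (by positivity) (fun i => (hX1 i).continuousOn) hM
    (hR (mem_closedBall_iff_norm.2 hy.1.le)) ?_ fun k => ?_
  · have h0 : Filter.Tendsto (fun k : ℕ => ((1 / 2 : ℝ) ^ k) ^ r * ‖x - y‖) Filter.atTop (𝓝 0) := by
      have := ((tendsto_pow_atTop_nhds_zero_of_lt_one (r := (1 / 2 : ℝ)) (by norm_num)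
        (by norm_num)).pow r).mul_const ‖x - y‖
      simpa [hr] using this
    rw [tendsto_iff_norm_sub_tendsto_zero]
    exact squeeze_zero (fun _ => norm_nonneg _) (fun k => norm_sub_rev y (u k) ▸ hdist k) h0
  · have hle : ‖y - u k‖ ≤ ‖x - y‖ :=
      (hdist k).trans (mul_le_of_le_one_left (norm_nonneg _)
        (pow_le_one₀ (by positivity) (pow_le_one₀ (by norm_num) (by norm_num))))
    refine (hz1 (u k) (hsmall _ hle).1 (y - u k) (hsmall _ hle).2).mono (by positivity) ?_
    calc C * ‖y - u k‖ ^ (r : ℝ)⁻¹ ≤ C * (((1 / 2) ^ k) ^ r * ‖x - y‖) ^ (r : ℝ)⁻¹ := by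
          gcongr
          exact hdist k
      _ = 2 * C * ‖x - y‖ ^ (r : ℝ)⁻¹ * (1 / 2) ^ (k + 1) := by
          rw [Real.mul_rpow (by positivity) (norm_nonneg _),
            Real.pow_rpow_inv_natCast (by positivity) hr, pow_succ]
          ring

/-- The Hölder bound for steering on compact subsets of a domain. -/
lemma exists_steer_compact [FiniteDimensional ℝ V] (hΩ : IsOpen Ω) (hΩc : IsPreconnected Ω)
    (hr : r ≠ 0) (hX : ∀ i, w i ≤ r → ContDiffOn ℝ ((r - w i : ℕ)) (X i) Ω) (hw : ∀ i, 1 ≤ w i)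
    (hX1 : ∀ i, ContDiffOn ℝ 1 (X i) Ω) {M : ℝ} (hM : ∀ i, ∀ x ∈ Ω, ‖X i x‖ ≤ M)
    (hH : HormSpan X w r Ω) {K : Set V} (hK : IsCompact K) (hKΩ : K ⊆ Ω) :
    ∃ C : ℝ, 0 < C ∧ ∀ x ∈ K, ∀ y ∈ K, Steer X w Ω (C * ‖x - y‖ ^ (r : ℝ)⁻¹) x y := by
  have hXc : ∀ i, ContinuousOn (X i) Ω := fun i => (hX1 i).continuousOn
  have hloc := fun x₀ (hx₀ : x₀ ∈ Ω) => exists_steer_ball hΩ hr hX hw hX1 hM hH hx₀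
  have hcomm : ∀ {δ₁ δ₂ : ℝ} {x y z : V}, 0 ≤ δ₁ → 0 ≤ δ₂ → Steer X w Ω δ₁ x y →
      Steer X w Ω δ₂ y z → Steer X w Ω (4 * (δ₁ + δ₂)) x z := fun h₁ h₂ hxy hyz =>
    Steer.trans hw (add_nonneg h₁ h₂) hXc hM (hxy.mono h₁ (by linarith))
      (hyz.mono h₂ (by linarith))
  have hjoin : ∀ x ∈ Ω, ∀ y ∈ Ω, ∃ δ, 0 ≤ δ ∧ Steer X w Ω δ x y := by
    intro x hx y hy
    refine hΩc.induction₂ (fun x y => ∃ δ, 0 ≤ δ ∧ Steer X w Ω δ x y) (fun x₀ hx₀ => ?_) ?_ ?_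
      hx hy
    · obtain ⟨C, hC, ρ, hρ, h⟩ := hloc x₀ hx₀
      filter_upwards [nhdsWithin_le_nhds (Metric.ball_mem_nhds x₀ hρ)] with z hz
      exact ⟨_, by positivity, h x₀ (Metric.mem_ball_self hρ) z hz⟩
    · rintro a b c - - - ⟨δ₁, h₁, h₁'⟩ ⟨δ₂, h₂, h₂'⟩
      exact ⟨_, by positivity, hcomm h₁ h₂ h₁' h₂'⟩
    · rintro a b - - ⟨δ, h, h'⟩
      exact ⟨δ, h, h'.symm h hXc hM⟩
  suffices h : ∃ C : ℝ, 0 < C ∧ ∀ q ∈ K ×ˢ K,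
      Steer X w Ω (C * ‖q.1 - q.2‖ ^ (r : ℝ)⁻¹) q.1 q.2 by
    obtain ⟨C, hC, h⟩ := h
    exact ⟨C, hC, fun x hx y hy => h (x, y) ⟨hx, hy⟩⟩
  refine (hK.prod hK).induction_on ⟨1, one_pos, by simp⟩
    (fun s t hst ⟨C, hC, h⟩ => ⟨C, hC, fun q hq => h q (hst hq)⟩) ?_ ?_
  · rintro s t ⟨C₁, hC₁, h₁⟩ ⟨C₂, hC₂, h₂⟩
    refine ⟨C₁ + C₂, by positivity, ?_⟩
    rintro q (hq | hq)
    · exact (h₁ q hq).mono (by positivity) (by gcongr; linarith)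
    · exact (h₂ q hq).mono (by positivity) (by gcongr; linarith)
  · rintro ⟨x₀, y₀⟩ ⟨hx₀, hy₀⟩
    replace hx₀ := hKΩ hx₀
    replace hy₀ := hKΩ hy₀
    obtain ⟨C₁, hC₁, ρ₁, hρ₁, h₁⟩ := hloc x₀ hx₀
    rcases eq_or_ne x₀ y₀ with rfl | hne
    · exact ⟨_, mem_nhdsWithin_of_mem_nhds
        (prod_mem_nhds (Metric.ball_mem_nhds x₀ hρ₁) (Metric.ball_mem_nhds x₀ hρ₁)),
        C₁, hC₁, fun q hq => h₁ _ hq.1 _ hq.2⟩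
    · obtain ⟨C₂, hC₂, ρ₂, hρ₂, h₂⟩ := hloc y₀ hy₀
      obtain ⟨δ, hδ, hδ'⟩ := hjoin x₀ hx₀ y₀ hy₀
      have hd : 0 < ‖x₀ - y₀‖ := norm_sub_pos_iff.2 hne
      set d := ‖x₀ - y₀‖ with hd'
      set D := 4 * (4 * (C₁ * ρ₁ ^ (r : ℝ)⁻¹ + δ) + C₂ * ρ₂ ^ (r : ℝ)⁻¹) with hD
      have hDpos : 0 < D := by positivity
      refine ⟨_, mem_nhdsWithin_of_mem_nhds
        (prod_mem_nhds (Metric.ball_mem_nhds x₀ (lt_min hρ₁ (by positivity : 0 < d / 4)))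
          (Metric.ball_mem_nhds y₀ (lt_min hρ₂ (by positivity : 0 < d / 4)))),
        D / (d / 2) ^ (r : ℝ)⁻¹, by positivity, ?_⟩
      rintro ⟨x, y⟩ ⟨hx, hy⟩
      simp only [mem_ball_iff_norm, lt_min_iff] at hx hy ⊢
      have hsep : d / 2 ≤ ‖x - y‖ := by
        have : d ≤ ‖x - y‖ + ‖x - x₀‖ + ‖y - y₀‖ := by
          rw [hd', show x₀ - y₀ = (x - y) - (x - x₀) + (y - y₀) by abel]
          exact (norm_add_le _ _).trans (add_le_add_left (norm_sub_le _ _) _)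
        linarith
      have s₁ : Steer X w Ω (C₁ * ρ₁ ^ (r : ℝ)⁻¹) x x₀ :=
        (h₁ x (mem_ball_iff_norm.2 hx.1) x₀ (Metric.mem_ball_self hρ₁)).mono (by positivity)
          (by gcongr; exact hx.1.le)
      have s₂ : Steer X w Ω (C₂ * ρ₂ ^ (r : ℝ)⁻¹) y₀ y :=
        (h₂ y₀ (Metric.mem_ball_self hρ₂) y (mem_ball_iff_norm.2 hy.1)).mono (by positivity)
          (by gcongr; rw [norm_sub_rev]; exact hy.1.le)
      refine (hcomm (by positivity) (by positivity) (hcomm (by positivity) hδ s₁ hδ') s₂).mono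
        hDpos.le ?_
      rw [div_mul_eq_mul_div, le_div_iff₀ (by positivity)]
      gcongr

lemma dCtrl_le_of_steer {δ : ℝ} {x y : V} (hδ : 0 < δ) (h : Steer X w Ω δ x y) :
    dCtrl X w Ω x y ≤ δ := by
  obtain ⟨φ, -, h⟩ := h
  exact csInf_le ⟨0, fun _ h => h.1.le⟩ ⟨hδ, φ, h⟩

lemma dCtrl_self_le {x : V} (hx : x ∈ Ω) : dCtrl X w Ω x x ≤ 0 :=
  le_of_forall_pos_le_add fun ε hε => by
    simpa using dCtrl_le_of_steer (X := X) (w := w) hε (Steer.refl hε.le hx)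

lemma IsCtrlAdmissible.norm_sub_le {δ M : ℝ} {x y : V} {φ : ℝ → V}
    (h : IsCtrlAdmissible X w Ω δ x y φ) (hδ : 0 ≤ δ) (hM : ∀ i, ∀ x ∈ Ω, ‖X i x‖ ≤ M) :
    ‖x - y‖ ≤ ∑ i, δ ^ w i * M := by
  obtain ⟨a, h1, h2, h3, -, h5, h6⟩ := h
  have h7 := h6 1 (by simp)
  rw [h3] at h7
  rw [norm_sub_rev, h7, add_sub_cancel_left]
  have := intervalIntegral.norm_integral_le_of_norm_le_const (a := 0) (b := 1)
    (f := fun s => ∑ i, a i s • X i (φ s)) (C := ∑ i, δ ^ w i * M) fun t ht => by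
      rw [uIoc_of_le zero_le_one] at ht
      have ht := Ioc_subset_Icc_self ht
      exact norm_control_le hδ hM (fun i => h5 i t ht) (h1 t ht)
  simpa using this

lemma exists_mul_norm_le_of_admissible (hw : ∀ i, 1 ≤ w i) (hΩb : Bornology.IsBounded Ω) {M : ℝ}
    (hM0 : 0 ≤ M) (hM : ∀ i, ∀ x ∈ Ω, ‖X i x‖ ≤ M) :
    ∃ c > 0, ∀ {δ x y φ}, 0 < δ → IsCtrlAdmissible X w Ω δ x y φ → c * ‖x - y‖ ≤ δ := by
  obtain ⟨D, hD⟩ := Metric.isBounded_iff.1 hΩb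
  set A := Fintype.card ι * M + |D| + 1 with hA
  have hA0 : 0 < A := by positivity
  have hcard : 0 ≤ Fintype.card ι * M := by positivity
  refine ⟨A⁻¹, by positivity, fun {δ x y φ} hδ h => ?_⟩
  rw [inv_mul_le_iff₀ hA0]
  rcases le_total δ 1 with hδ1 | hδ1
  · calc ‖x - y‖ ≤ ∑ i, δ ^ w i * M := h.norm_sub_le hδ.le hM
      _ ≤ ∑ _i : ι, δ * M := by
          gcongr with i
          exact pow_le_of_le_one hδ.le hδ1 (Nat.one_le_iff_ne_zero.1 (hw i))
      _ = Fintype.card ι * M * δ := by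
          rw [Finset.sum_const, Finset.card_univ, nsmul_eq_mul]
          ring
      _ ≤ A * δ := by gcongr; linarith [abs_nonneg D]
  · obtain ⟨a, h1, h2, h3, -⟩ := h
    have := hD (h1 0 (by simp)) (h1 1 (by simp))
    rw [h2, h3, dist_eq_norm] at this
    calc ‖x - y‖ ≤ A := by linarith [le_abs_self D]
      _ ≤ A * δ := le_mul_of_one_le_right hA0.le hδ1

theorem exists_dCtrl_bounds [FiniteDimensional ℝ V] (hΩ : IsOpen Ω) (hΩc : IsPreconnected Ω)
    (hΩb : Bornology.IsBounded Ω) (hr : r ≠ 0)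
    (hX : ∀ i, w i ≤ r → ContDiffOn ℝ ((r - w i : ℕ)) (X i) Ω) (hw : ∀ i, 1 ≤ w i)
    (hX1 : ∀ i, ContDiffOn ℝ 1 (X i) Ω) {M : ℝ} (hM0 : 0 ≤ M) (hM : ∀ i, ∀ x ∈ Ω, ‖X i x‖ ≤ M)
    (hH : HormSpan X w r Ω) {K : Set V} (hK : IsCompact K) (hKΩ : K ⊆ Ω) :
    ∃ c₁ > (0 : ℝ), ∃ c₂ > (0 : ℝ), ∀ x ∈ K, ∀ y ∈ K,
      c₁ * ‖x - y‖ ≤ dCtrl X w Ω x y ∧ dCtrl X w Ω x y ≤ c₂ * ‖x - y‖ ^ (r : ℝ)⁻¹ := by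
  obtain ⟨C, hC, hsteer⟩ := exists_steer_compact hΩ hΩc hr hX hw hX1 hM hH hK hKΩ
  obtain ⟨c, hc, hlow⟩ := exists_mul_norm_le_of_admissible hw hΩb hM0 hM
  refine ⟨c, hc, C, hC, fun x hx y hy => ⟨?_, ?_⟩⟩
  · obtain ⟨φ, -, hφ⟩ := (hsteer x hx y hy).mono (δ' := C * ‖x - y‖ ^ (r : ℝ)⁻¹ + 1)
      (by positivity) (by linarith)
    exact le_csInf ⟨_, by positivity, φ, hφ⟩ fun δ ⟨hδ, ψ, hψ⟩ => hlow hδ hψ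
  · rcases eq_or_ne x y with rfl | hne
    · exact (dCtrl_self_le (hKΩ hx)).trans (by positivity)
    · have : 0 < ‖x - y‖ := norm_sub_pos_iff.2 hne
      exact dCtrl_le_of_steer (by positivity) (hsteer x hx y hy)

end GlobalBound

/-- Fefferman–Phong-type bounds for the control distance
`d₁`. Under Assumptions (C), for any `Ω' ⋐ Ω` there exist `c₁, c₂ > 0` such
that `c₁|x-y| ≤ d₁(x,y) ≤ c₂|x-y|^{1/r}` for all `x, y ∈ Ω'`. -/
theorem ctrl_distance_bounds
    (p n r : ℕ) (hr : 2 ≤ r) (hnp : n < p)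
    (Ω : Set (E p)) (hΩo : IsOpen Ω) (hΩconn : IsConnected Ω)
    (hΩb : Bornology.IsBounded Ω)
    (X : Fin (n + 1) → E p → E p)
    (hXreg : ∀ i : Fin n, ContDiffOn ℝ (r - 1 : ℕ) (X i.succ) (closure Ω))
    (hX0reg : ContDiffOn ℝ (r - 2 : ℕ) (X 0) (closure Ω))
    (hHor : HormSpan X wgt r Ω)
    (hX0C1 : r = 2 → ContDiffOn ℝ 1 (X 0) (closure Ω))
    (Ω' : Set (E p)) (hΩ'o : IsOpen Ω') (hΩ'sub : closure Ω' ⊆ Ω)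
    (hΩ'cpt : IsCompact (closure Ω')) :
    ∃ c₁ > (0:ℝ), ∃ c₂ > (0:ℝ), ∀ x ∈ Ω', ∀ y ∈ Ω',
      c₁ * ‖x - y‖ ≤ dCtrl X wgt Ω x y ∧
      dCtrl X wgt Ω x y ≤ c₂ * ‖x - y‖ ^ ((r : ℝ)⁻¹) := by
  have hsub : Ω ⊆ closure Ω := subset_closure
  have hw : ∀ i : Fin (n + 1), 1 ≤ wgt i := fun i => by unfold wgt; split_ifs <;> norm_num
  have hX : ∀ i, wgt i ≤ r → ContDiffOn ℝ ((r - wgt i : ℕ)) (X i) (closure Ω) := fun i _ => by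
    refine Fin.cases ?_ (fun j => ?_) i
    · simpa [wgt] using hX0reg
    · simpa [wgt, Fin.succ_ne_zero] using hXreg j
  have hX1 : ∀ i, ContDiffOn ℝ 1 (X i) (closure Ω) := fun i => by
    refine Fin.cases ?_ (fun j => ?_) i
    · rcases hr.eq_or_lt with h | h
      · exact hX0C1 h.symm
      · exact hX0reg.of_le (by exact_mod_cast (by omega : 1 ≤ r - 2))
    · exact (hXreg j).of_le (by exact_mod_cast (by omega : 1 ≤ r - 1))
  choose B hB using fun i =>
    hΩb.isCompact_closure.exists_bound_of_continuousOn (hX1 i).continuousOn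
  have hM : ∀ i, ∀ x ∈ Ω, ‖X i x‖ ≤ ∑ j, |B j| := fun i x hx =>
    ((hB i x (hsub hx)).trans (le_abs_self _)).trans
      (Finset.single_le_sum (f := fun j => |B j|) (fun j _ => abs_nonneg _) (Finset.mem_univ i))
  obtain ⟨c₁, hc₁, c₂, hc₂, h⟩ := exists_dCtrl_bounds hΩo hΩconn.isPreconnected hΩb (by omega)
    (fun i hi => (hX i hi).mono hsub) hw (fun i => (hX1 i).mono hsub)
    (Finset.sum_nonneg fun j _ => abs_nonneg (B j)) hM hHor hΩ'cpt hΩ'sub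
  exact ⟨c₁, hc₁, c₂, hc₂, fun x hx y hy => h x (subset_closure hx) y (subset_closure hy)⟩

end
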